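/- arXiv:2203.02283 — 2 statements merged into one kernel-verified Lean document; each statement's English description precedes it below -/
import Mathlib

section
/- z_2(23) = 115: there exists a 23×23 (0,1)-matrix with 115 ones containing no all-one 2×2 minor, and every 23×23 (0,1)-matrix containing no all-one 2×2 minor has at most 115 ones. Moreover, a maximal example is given by the circulant matrix whose rows are the cyclic shifts modulo 23 of the set {0, 1, 3, 8, 14} (a set of five residues whose pairwise differences modulo 23 are all distinct). -/
/-- An `m × n` (0,1)-matrix (entries as `Bool`) is `(a,b)`-admissible if it contains no
all-one `a × b` minor. -/
def Admissible {m n : ℕ} (a b : ℕ) (M : Fin m → Fin n → Bool) : Prop :=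
  ¬ ∃ (R : Finset (Fin m)) (C : Finset (Fin n)),
      R.card = a ∧ C.card = b ∧ ∀ i ∈ R, ∀ j ∈ C, M i j = true

/-- The number of ones in a (0,1)-matrix. -/
def onesCount {m n : ℕ} (M : Fin m → Fin n → Bool) : ℕ :=
  (Finset.univ.filter fun p : Fin m × Fin n => M p.1 p.2 = true).card

/-- The circulant (0,1)-matrix of a subset `S ⊆ ℤ/nℤ`: its `(i,j)` entry is 1 exactly
when `j - i mod n ∈ S`. -/
def circulant (n : ℕ) (S : Finset (ZMod n)) : Fin n → Fin n → Bool :=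
  fun i j => decide (((j : ℕ) : ZMod n) - ((i : ℕ) : ZMod n) ∈ S)

open Finset
open scoped Matrix

/-- A square 0-1 matrix of order 23 with 116 ones in which distinct rows, and distinct columns,
have at most one common one. -/
structure Overfull {ι : Type*} [Fintype ι] (x : Matrix ι ι ℤ) : Prop where
  card_index : Fintype.card ι = 23
  zero_or_one : ∀ p l, x p l = 0 ∨ x p l = 1
  row_inner : ∀ p q, p ≠ q → ∑ l, x p l * x q l ≤ 1
  col_inner : ∀ l m, l ≠ m → ∑ p, x p l * x p m ≤ 1
  total : ∑ p, ∑ l, x p l = 116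

/-- The excess of a row: its number of ones minus five. -/
def excess {ι : Type*} [Fintype ι] (x : Matrix ι ι ℤ) (p : ι) : ℤ := ∑ l, x p l - 5

/-- The sum of the excesses of the columns that meet a given row. -/
def colExcess {ι : Type*} [Fintype ι] (x : Matrix ι ι ℤ) (p : ι) : ℤ :=
  ∑ l, x p l * excess xᵀ l

/-- The number of rows without a common one with a given row, see `Overfull.deficiency_eq`. -/
def deficiency {ι : Type*} [Fintype ι] (x : Matrix ι ι ℤ) (p : ι) : ℤ :=
  2 - 4 * excess x p - colExcess x p

/-- The sum of the negative parts of the row excesses. -/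
def shortfall {ι : Type*} [Fintype ι] (x : Matrix ι ι ℤ) : ℤ := ∑ p, max (-excess x p) 0

namespace Overfull

variable {ι : Type*} [Fintype ι] {x : Matrix ι ι ℤ}

theorem transpose (h : Overfull x) : Overfull xᵀ where
  card_index := h.card_index
  zero_or_one p l := h.zero_or_one l p
  row_inner := h.col_inner
  col_inner := h.row_inner
  total := Finset.sum_comm.trans h.total

theorem nonneg (h : Overfull x) (p l : ι) : 0 ≤ x p l := by
  rcases h.zero_or_one p l with e | e <;> omega

theorem le_one (h : Overfull x) (p l : ι) : x p l ≤ 1 := by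
  rcases h.zero_or_one p l with e | e <;> omega

theorem mul_self_eq (h : Overfull x) (p l : ι) : x p l * x p l = x p l := by
  rcases h.zero_or_one p l with e | e <;> simp [e]

theorem inner_nonneg (h : Overfull x) (p q : ι) : 0 ≤ ∑ l, x p l * x q l :=
  Finset.sum_nonneg fun l _ => mul_nonneg (h.nonneg p l) (h.nonneg q l)

theorem sum_const (h : Overfull x) (c : ℤ) : ∑ _p : ι, c = 23 * c := by
  simp [h.card_index]

theorem sum_row (p : ι) : ∑ l, x p l = 5 + excess x p := by
  unfold excess; ring

theorem sum_col (l : ι) : ∑ p, x p l = 5 + excess xᵀ l := by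
  simp [excess]

theorem sum_excess (h : Overfull x) : ∑ p, excess x p = 1 := by
  unfold excess
  rw [Finset.sum_sub_distrib, h.total, h.sum_const]
  norm_num

/-- Weighted double counting of the columns meeting row `p`. -/
theorem sum_mul_inner (f : ι → ℤ) (p : ι) :
    ∑ q, f q * ∑ l, x p l * x q l = ∑ l, x p l * ∑ q, x q l * f q := by
  simp_rw [Finset.mul_sum]
  rw [Finset.sum_comm]
  exact Finset.sum_congr rfl fun l _ => Finset.sum_congr rfl fun q _ => by ring

theorem sum_inner (p : ι) :
    ∑ q, ∑ l, x p l * x q l = 5 * (5 + excess x p) + colExcess x p := by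
  have := sum_mul_inner (x := x) (fun _ => 1) p
  simp only [one_mul, mul_one] at this
  rw [this, ← sum_row, colExcess, Finset.mul_sum, ← Finset.sum_add_distrib]
  refine Finset.sum_congr rfl fun l _ => ?_
  rw [sum_col]; ring

theorem sum_inner_self (h : Overfull x) (p : ι) : ∑ l, x p l * x p l = 5 + excess x p := by
  rw [← sum_row]
  exact Finset.sum_congr rfl fun l _ => h.mul_self_eq p l

theorem deficiency_eq [DecidableEq ι] (h : Overfull x) (p : ι) :
    deficiency x p = ∑ q ∈ univ.erase p, (1 - ∑ l, x p l * x q l) := by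
  have h1 := Finset.add_sum_erase univ (fun q => 1 - ∑ l, x p l * x q l) (Finset.mem_univ p)
  have h2 : ∑ q, (1 - ∑ l, x p l * x q l) = 23 - (5 * (5 + excess x p) + colExcess x p) := by
    rw [Finset.sum_sub_distrib, sum_inner, h.sum_const, mul_one]
  rw [h2, h.sum_inner_self] at h1
  unfold deficiency
  linarith

theorem disjoint_nonneg [DecidableEq ι] (h : Overfull x) {p q : ι} (hq : q ∈ univ.erase p) :
    0 ≤ 1 - ∑ l, x p l * x q l := by
  linarith [h.row_inner p q (Finset.ne_of_mem_erase hq).symm]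

theorem deficiency_nonneg (h : Overfull x) (p : ι) : 0 ≤ deficiency x p := by
  classical
  rw [h.deficiency_eq]
  exact Finset.sum_nonneg fun q hq => h.disjoint_nonneg hq

theorem sum_colExcess (h : Overfull x) : ∑ p, colExcess x p = 5 + ∑ l, excess xᵀ l ^ 2 := by
  unfold colExcess
  rw [Finset.sum_comm]
  have : ∀ l, ∑ p, x p l * excess xᵀ l = 5 * excess xᵀ l + excess xᵀ l ^ 2 := fun l => by
    rw [← Finset.sum_mul, sum_col]; ring
  simp_rw [this]
  rw [Finset.sum_add_distrib, ← Finset.mul_sum, h.transpose.sum_excess]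
  ring

theorem sum_deficiency (h : Overfull x) :
    ∑ p, deficiency x p = 37 - ∑ l, excess xᵀ l ^ 2 := by
  unfold deficiency
  rw [Finset.sum_sub_distrib, Finset.sum_sub_distrib, ← Finset.mul_sum, h.sum_excess,
    h.sum_colExcess, h.sum_const]
  ring

/-- Rows on a column `l` missed by `p` that are disjoint from `p`. -/
theorem sub_le_sum_disjoint (h : Overfull x) {p l : ι} (hl : x p l = 0) :
    excess xᵀ l - excess x p ≤ ∑ q, x q l * (1 - ∑ m, x p m * x q m) := by
  have h1 := sum_mul_inner (x := x) (fun q => x q l) p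
  have h2 : ∑ m, x p m * ∑ q, x q m * x q l ≤ ∑ m, x p m := by
    refine Finset.sum_le_sum fun m _ => ?_
    rcases h.zero_or_one p m with e | e
    · simp [e]
    · have hm : m ≠ l := by rintro rfl; omega
      rw [e, one_mul]
      exact h.col_inner m l hm
  rw [sum_row] at h2
  simp_rw [mul_sub, mul_one]
  rw [Finset.sum_sub_distrib, sum_col, h1]
  linarith

/-- A 0-1 weighting that vanishes at `p` bounds the deficiency from below. -/
theorem sum_le_deficiency (h : Overfull x) {p : ι} (w : ι → ℤ) (hp : w p = 0)
    (hw : ∀ q, w q ≤ 1) :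
    ∑ q, w q * (1 - ∑ m, x p m * x q m) ≤ deficiency x p := by
  classical
  rw [h.deficiency_eq, ← Finset.add_sum_erase univ _ (Finset.mem_univ p), hp, zero_mul, zero_add]
  refine Finset.sum_le_sum fun q hq => ?_
  nlinarith [h.disjoint_nonneg hq, hw q]

theorem sub_le_deficiency (h : Overfull x) {p l : ι} (hl : x p l = 0) :
    excess xᵀ l - excess x p ≤ deficiency x p :=
  (h.sub_le_sum_disjoint hl).trans
    (h.sum_le_deficiency (fun q => x q l) hl fun q => h.le_one q l)

theorem sub_add_sub_le_deficiency (h : Overfull x) {p l m : ι} (hlm : l ≠ m) (hl : x p l = 0)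
    (hm : x p m = 0) :
    (excess xᵀ l - excess x p) + (excess xᵀ m - excess x p) - 1 ≤ deficiency x p := by
  have h1 := h.sub_le_sum_disjoint hl
  have h2 := h.sub_le_sum_disjoint hm
  have h3 := h.sum_le_deficiency (p := p) (fun q => x q l + x q m - x q l * x q m)
    (by simp [hl, hm]) fun q => by
      rcases h.zero_or_one q l with e | e <;> rcases h.zero_or_one q m with e' | e' <;> simp [e, e']
  have h4 : ∑ q, x q l * x q m * (1 - ∑ k, x p k * x q k) ≤ 1 := by
    refine le_trans (Finset.sum_le_sum fun q _ => ?_) (h.col_inner l m hlm)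
    have := h.inner_nonneg p q
    nlinarith [mul_nonneg (h.nonneg q l) (h.nonneg q m)]
  simp only [sub_mul, add_mul, Finset.sum_sub_distrib, Finset.sum_add_distrib] at h1 h2 h3 h4 ⊢
  linarith

theorem exists_excess_pos (h : Overfull x) : ∃ p, 1 ≤ excess x p := by
  by_contra! hc
  have : ∑ p, excess x p ≤ 0 := Finset.sum_nonpos fun p _ => by linarith [hc p]
  linarith [h.sum_excess]

theorem colExcess_add_deficiency (p : ι) :
    colExcess x p + deficiency x p = 2 - 4 * excess x p := by
  unfold deficiency; ring

theorem sum_colExcess_transpose (p : ι) :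
    ∑ l, x p l * colExcess xᵀ l = ∑ q, excess x q * ∑ l, x p l * x q l := by
  rw [sum_mul_inner]
  simp [colExcess]

theorem sum_deficiency_transpose (p : ι) :
    ∑ l, x p l * deficiency xᵀ l
      = 2 * (5 + excess x p) - 4 * colExcess x p - ∑ l, x p l * colExcess xᵀ l := by
  have : ∀ l, x p l * deficiency xᵀ l
      = 2 * x p l - 4 * (x p l * excess xᵀ l) - x p l * colExcess xᵀ l := fun l => by
    unfold deficiency; ring
  simp_rw [this]
  rw [Finset.sum_sub_distrib, Finset.sum_sub_distrib, ← Finset.mul_sum, ← Finset.mul_sum, sum_row]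
  rfl

theorem one_le_deficiency_of_excess_eq_zero (h : Overfull x) {p : ι} (hp : excess x p = 0) :
    1 ≤ deficiency x p := by
  classical
  by_contra! hc
  have hd : deficiency x p = 0 := le_antisymm (by omega) (h.deficiency_nonneg p)
  have hT : colExcess x p = 2 := by linarith [colExcess_add_deficiency (x := x) p]
  have hoff : ∀ l, x p l = 0 → excess xᵀ l ≤ 0 := fun l hl => by
    linarith [h.sub_le_deficiency hl]
  have hinner : ∀ q, q ≠ p → ∑ l, x p l * x q l = 1 := fun q hq => by
    have h1 := h.deficiency_eq p
    rw [hd] at h1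
    have := (Finset.sum_eq_zero_iff_of_nonneg fun q hq => h.disjoint_nonneg hq).1 h1.symm q
      (by simp [hq])
    linarith
  have hsumoff : ∑ l, (1 - x p l) * excess xᵀ l = -1 := by
    have : ∑ l, (1 - x p l) * excess xᵀ l = ∑ l, excess xᵀ l - colExcess x p := by
      rw [colExcess, ← Finset.sum_sub_distrib]
      exact Finset.sum_congr rfl fun l _ => by ring
    rw [this, h.transpose.sum_excess, hT]; norm_num
  -- the part of `colExcess x q` outside of `p` is at least `-1`
  have hpart : ∀ q, -1 ≤ ∑ l, x q l * ((1 - x p l) * excess xᵀ l) := fun q => by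
    rw [← hsumoff]
    refine Finset.sum_le_sum fun l _ => ?_
    rcases h.zero_or_one p l with e | e
    · have := hoff l e
      rw [e]
      nlinarith [h.le_one q l, h.nonneg q l]
    · simp [e]
  have hsplit : ∀ q, colExcess x q = ∑ l, x q l * ((1 - x p l) * excess xᵀ l)
      + ∑ l, x p l * x q l * excess xᵀ l := fun q => by
    rw [colExcess, ← Finset.sum_add_distrib]
    exact Finset.sum_congr rfl fun l _ => by ring
  have hcommon : ∀ q l, q ≠ p → x p l = 1 → x q l = 1 →
      ∑ m, x p m * x q m * excess xᵀ m = excess xᵀ l := fun q l hq hpl hql => by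
    have h1 := hinner q hq
    rw [← Finset.add_sum_erase univ _ (Finset.mem_univ l), hpl, hql] at h1
    have h2 : ∑ m ∈ univ.erase l, x p m * x q m = 0 := by linarith
    rw [Finset.sum_eq_zero_iff_of_nonneg fun m _ => mul_nonneg (h.nonneg p m) (h.nonneg q m)] at h2
    rw [← Finset.add_sum_erase univ _ (Finset.mem_univ l), hpl, hql,
      Finset.sum_eq_zero fun m hm => by rw [h2 m hm, zero_mul]]
    ring
  obtain ⟨q, hq⟩ := h.exists_excess_pos
  have hqp : q ≠ p := by rintro rfl; omega
  obtain ⟨l, -, hl⟩ : ∃ l ∈ univ, x p l * x q l ≠ 0 :=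
    Finset.exists_ne_zero_of_sum_ne_zero (by rw [hinner q hqp]; norm_num)
  have hpl : x p l = 1 := (h.zero_or_one p l).resolve_left fun e => hl (by simp [e])
  have hql : x q l = 1 := (h.zero_or_one q l).resolve_left fun e => hl (by simp [e])
  have hbound : ∀ r, r ≠ p → x r l = 1 → 4 * excess x r ≤ 3 - excess xᵀ l := fun r hr hrl => by
    have h1 := hsplit r
    rw [hcommon r l hr hpl hrl] at h1
    linarith [hpart r, h.deficiency_nonneg r, colExcess_add_deficiency (x := x) r]
  have htl : -4 ≤ excess xᵀ l := by
    have := Finset.single_le_sum (f := fun r => x r l) (fun r _ => h.nonneg r l)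
      (Finset.mem_univ p)
    simp only [sum_col, hpl] at this
    linarith
  have htneg : excess xᵀ l ≤ -1 := by linarith [hbound q hqp hql]
  have hS : colExcess xᵀ l ≤ 4 + excess xᵀ l := by
    have h1 : colExcess xᵀ l ≤ ∑ r ∈ univ.erase p, x r l := by
      change ∑ r, x r l * excess x r ≤ _
      rw [← Finset.add_sum_erase univ _ (Finset.mem_univ p), hp, mul_zero, zero_add]
      refine Finset.sum_le_sum fun r hr => ?_
      rcases h.zero_or_one r l with e | e
      · simp [e]
      · have := hbound r (Finset.ne_of_mem_erase hr) e
        rw [e]; omega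
    have h2 := Finset.add_sum_erase univ (fun r => x r l) (Finset.mem_univ p)
    simp only [sum_col, hpl] at h2
    linarith
  have he : deficiency xᵀ l ≤ 1 := by
    have h1 : ∑ m, x p m * deficiency xᵀ m = 1 := by
      rw [sum_deficiency_transpose, sum_colExcess_transpose, hp, hT]
      have : ∑ q, excess x q * ∑ l, x p l * x q l = ∑ q, excess x q := by
        refine Finset.sum_congr rfl fun q _ => ?_
        by_cases hq : q = p
        · rw [hq, hp, zero_mul]
        · rw [hinner q hq, mul_one]
      rw [this, h.sum_excess]; norm_num
    have h2 := Finset.single_le_sum (f := fun m => x p m * deficiency xᵀ m)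
      (fun m _ => mul_nonneg (h.nonneg p m) (h.transpose.deficiency_nonneg m)) (Finset.mem_univ l)
    simp only [h1, hpl, one_mul] at h2
    exact h2
  linarith [colExcess_add_deficiency (x := xᵀ) l]

theorem sum_max_excess (h : Overfull x) : ∑ p, max (excess x p) 0 = 1 + shortfall x := by
  rw [shortfall, ← h.sum_excess, ← Finset.sum_add_distrib]
  exact Finset.sum_congr rfl fun p _ => by omega

theorem shortfall_le_sum_sq (h : Overfull x) : 2 * shortfall x + 1 ≤ ∑ p, excess x p ^ 2 := by
  rw [shortfall, Finset.mul_sum, ← h.sum_excess, ← Finset.sum_add_distrib]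
  refine Finset.sum_le_sum fun p _ => ?_
  rcases le_total 0 (excess x p) with e | e
  · rw [max_eq_right (by omega)]
    nlinarith [Int.le_self_sq (excess x p)]
  · rw [max_eq_left (by omega)]
    nlinarith [Int.le_self_sq (-excess x p)]

theorem sum_excess_sq_le (h : Overfull x) : ∑ l, excess xᵀ l ^ 2 ≤ 37 := by
  have := Finset.sum_nonneg fun p (_ : p ∈ univ) => h.deficiency_nonneg p
  linarith [h.sum_deficiency]

theorem one_le_deficiency_of_excess_nonpos (h : Overfull x) {p : ι} (hp : excess x p ≤ 0) :
    1 ≤ deficiency x p := by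
  rcases hp.eq_or_lt with hp | hp
  · exact h.one_le_deficiency_of_excess_eq_zero hp
  by_contra! hc
  have key : ∀ l, 2 * (1 - x p l) ≤ excess xᵀ l ^ 2 - excess xᵀ l := fun l => by
    rcases h.zero_or_one p l with e | e
    · have := h.sub_le_deficiency e
      have : excess xᵀ l ≤ -1 := by omega
      rw [e]; nlinarith
    · rw [e]; linarith [Int.le_self_sq (excess xᵀ l)]
  have := Finset.sum_le_sum fun l (_ : l ∈ univ) => key l
  rw [← Finset.mul_sum, Finset.sum_sub_distrib, Finset.sum_sub_distrib, sum_row,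
    h.transpose.sum_excess, h.sum_const] at this
  linarith [h.sum_excess_sq_le]

theorem one_sub_excess_le_deficiency (h : Overfull x) (p : ι) :
    1 - excess x p ≤ deficiency x p := by
  classical
  by_contra! hc
  have hs : excess x p < 0 := by
    have := h.deficiency_nonneg p
    by_contra! hs
    rcases hs.eq_or_lt with e | e
    · linarith [h.one_le_deficiency_of_excess_eq_zero e.symm]
    · omega
  have hoff : ∀ l, x p l = 0 → excess xᵀ l ≤ 0 := fun l hl => by
    have := h.sub_le_deficiency hl; omega
  have hn : 9 ≤ shortfall x := by
    have h1 := sum_deficiency_transpose (x := x) p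
    rw [sum_colExcess_transpose] at h1
    have h2 : 0 ≤ ∑ l, x p l * deficiency xᵀ l := Finset.sum_nonneg fun m _ =>
      mul_nonneg (h.nonneg p m) (h.transpose.deficiency_nonneg m)
    have h3 : excess x p * (5 + excess x p) - ∑ q ∈ univ.erase p, max (-excess x q) 0
        ≤ ∑ q, excess x q * ∑ l, x p l * x q l := by
      rw [← Finset.add_sum_erase univ _ (Finset.mem_univ p), h.sum_inner_self, sub_eq_add_neg,
        ← Finset.sum_neg_distrib]
      refine add_le_add_right (Finset.sum_le_sum fun q hq => ?_) _
      have a := h.inner_nonneg p q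
      have b := h.disjoint_nonneg hq
      rcases le_total 0 (excess x q) with e | e
      · rw [max_eq_right (by omega)]; nlinarith
      · rw [max_eq_left (by omega)]; nlinarith
    have h4 : shortfall x = max (-excess x p) 0 + ∑ q ∈ univ.erase p, max (-excess x q) 0 := by
      rw [shortfall, ← Finset.add_sum_erase univ _ (Finset.mem_univ p)]
    rw [max_eq_left (by omega)] at h4
    have h5 := colExcess_add_deficiency (x := x) p
    nlinarith
  have he : ∀ l, 1 - x p l ≤ deficiency xᵀ l := fun l => by
    rcases h.zero_or_one p l with e | e
    · rw [e]; linarith [h.transpose.one_le_deficiency_of_excess_nonpos (hoff l e)]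
    · rw [e]; linarith [h.transpose.deficiency_nonneg l]
  have h1 := Finset.sum_le_sum fun l (_ : l ∈ univ) => he l
  rw [Finset.sum_sub_distrib, h.sum_const, sum_row, h.transpose.sum_deficiency,
    Matrix.transpose_transpose] at h1
  linarith [h.shortfall_le_sum_sq]

theorem sum_excess_transpose_sq_le (h : Overfull x) : ∑ l, excess xᵀ l ^ 2 ≤ 15 := by
  have h1 := Finset.sum_le_sum fun p (_ : p ∈ univ) => h.one_sub_excess_le_deficiency p
  rw [Finset.sum_sub_distrib, h.sum_const, h.sum_excess, h.sum_deficiency] at h1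
  linarith

theorem shortfall_le_seven (h : Overfull x) : shortfall x ≤ 7 := by
  have := h.transpose.sum_excess_transpose_sq_le
  rw [Matrix.transpose_transpose] at this
  have := h.shortfall_le_sum_sq
  omega

theorem neg_three_le_excess (h : Overfull x) (p : ι) : -3 ≤ excess x p := by
  have h1 := h.transpose.sum_excess_transpose_sq_le
  rw [Matrix.transpose_transpose] at h1
  have h2 : excess x p ^ 2 ≤ ∑ q, excess x q ^ 2 :=
    Finset.single_le_sum (fun q _ => sq_nonneg (excess x q)) (Finset.mem_univ p)
  nlinarith

theorem neg_colExcess_le (h : Overfull x) (p : ι) :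
    -colExcess x p ≤ ∑ l, x p l * max (-excess xᵀ l) 0 := by
  rw [colExcess, ← Finset.sum_neg_distrib]
  refine Finset.sum_le_sum fun l _ => ?_
  nlinarith [h.nonneg p l, le_max_left (-excess xᵀ l) 0]

/-- A row of large excess meets columns of negative excess. -/
theorem excess_le_sum_neg (h : Overfull x) (p : ι) :
    4 * excess x p - 2 ≤ ∑ l, x p l * max (-excess xᵀ l) 0 := by
  linarith [h.neg_colExcess_le p, h.deficiency_nonneg p, colExcess_add_deficiency (x := x) p]

theorem sum_mul_le_shortfall (w : ι → ℤ) (hw : ∀ l, w l ≤ 1) :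
    ∑ l, w l * max (-excess x l) 0 ≤ shortfall x :=
  Finset.sum_le_sum fun l _ => by nlinarith [hw l, le_max_right (-excess x l) 0]

theorem excess_le_shortfall (h : Overfull x) (p : ι) :
    4 * excess x p - 2 ≤ shortfall xᵀ :=
  (h.excess_le_sum_neg p).trans (sum_mul_le_shortfall _ (h.le_one p))

theorem shortfall_lt (h : Overfull x) : 1 + shortfall x ≤ 2 * shortfall xᵀ := by
  have key : ∀ p, 2 * max (excess x p) 0 ≤ ∑ l, x p l * max (-excess xᵀ l) 0 := fun p => by
    have h1 := h.excess_le_sum_neg p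
    have h2 : 0 ≤ ∑ l, x p l * max (-excess xᵀ l) 0 :=
      Finset.sum_nonneg fun l _ => mul_nonneg (h.nonneg p l) (le_max_right _ _)
    omega
  have h1 := Finset.sum_le_sum fun p (_ : p ∈ univ) => key p
  rw [← Finset.mul_sum, h.sum_max_excess, Finset.sum_comm] at h1
  have h2 : ∑ l, ∑ p, x p l * max (-excess xᵀ l) 0 ≤ ∑ l, 4 * max (-excess xᵀ l) 0 := by
    refine Finset.sum_le_sum fun l _ => ?_
    rw [← Finset.sum_mul, sum_col]
    rcases le_total 0 (excess xᵀ l) with e | e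
    · rw [max_eq_right (by omega)]; simp
    · rcases e.eq_or_lt with e | e
      · simp [e]
      · rw [max_eq_left (by omega)]; nlinarith
  rw [← Finset.mul_sum] at h2
  change _ ≤ 4 * shortfall xᵀ at h2
  linarith

theorem eq_of_two_le_excess (h : Overfull x) {p q : ι} (hp : 2 ≤ excess x p)
    (hq : 2 ≤ excess x q) : p = q := by
  by_contra hne
  have h1 := h.excess_le_sum_neg p
  have h2 := h.excess_le_sum_neg q
  have h3 := sum_mul_le_shortfall (x := xᵀ) (fun l => x p l + x q l - x p l * x q l) fun l => by
    rcases h.zero_or_one p l with e | e <;> rcases h.zero_or_one q l with e' | e' <;> simp [e, e']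
  have h4 : ∑ l, x p l * x q l * max (-excess xᵀ l) 0 ≤ 3 * ∑ l, x p l * x q l := by
    rw [Finset.mul_sum]
    refine Finset.sum_le_sum fun l _ => ?_
    have : max (-excess xᵀ l) 0 ≤ 3 := by
      have := h.transpose.neg_three_le_excess l
      omega
    nlinarith [mul_nonneg (h.nonneg p l) (h.nonneg q l)]
  have h5 := h.row_inner p q hne
  have h6 := h.transpose.shortfall_le_seven
  simp only [sub_mul, add_mul, Finset.sum_sub_distrib, Finset.sum_add_distrib] at h3
  linarith

theorem eq_of_common (h : Overfull x) {p q l m : ι} (hlm : l ≠ m) (hpl : x p l = 1)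
    (hpm : x p m = 1) (hql : x q l = 1) (hqm : x q m = 1) : p = q := by
  classical
  by_contra hne
  have h1 := h.row_inner p q hne
  have h2 : ∑ k ∈ {l, m}, x p k * x q k ≤ ∑ k, x p k * x q k :=
    Finset.sum_le_sum_of_subset_of_nonneg (Finset.subset_univ _) fun k _ _ =>
      mul_nonneg (h.nonneg p k) (h.nonneg q k)
  rw [Finset.sum_pair hlm, hpl, hpm, hql, hqm] at h2
  linarith

theorem shortfall_transpose_le_five (h : Overfull x) : shortfall xᵀ ≤ 5 := by
  classical
  by_contra! hN
  have ht : ∀ l, excess xᵀ l ≤ 2 := fun l => by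
    have h1 := h.transpose.excess_le_shortfall l
    rw [Matrix.transpose_transpose] at h1
    have := h.shortfall_le_seven
    omega
  have htwo : ∑ l, (if 2 ≤ excess xᵀ l then (1 : ℤ) else 0) ≤ 1 := by
    rw [Finset.sum_boole]
    have : #{l | 2 ≤ excess xᵀ l} ≤ 1 := Finset.card_le_one.2 fun a ha b hb =>
      h.transpose.eq_of_two_le_excess (by simpa using ha) (by simpa using hb)
    exact_mod_cast this
  have key : ∀ p, 1 - excess x p + max (-excess x p) 0 ≤ deficiency x p := fun p => by
    rcases le_or_gt 0 (excess x p) with hs | hs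
    · rw [max_eq_right (by omega), add_zero]
      exact h.one_sub_excess_le_deficiency p
    rw [max_eq_left (by omega)]
    by_contra! hd
    have h1 := colExcess_add_deficiency (x := x) p
    have h2 : colExcess x p ≤ 6 + excess x p := by
      have : colExcess x p ≤ ∑ l, (x p l + if 2 ≤ excess xᵀ l then (1 : ℤ) else 0) := by
        refine Finset.sum_le_sum fun l _ => ?_
        have := ht l
        rcases h.zero_or_one p l with e | e <;> rw [e] <;> split_ifs <;> omega
      rw [Finset.sum_add_distrib, sum_row] at this
      linarith
    have hs1 : excess x p = -1 := by omega
    have h3 : colExcess x p ≤ ∑ l, x p l * max (excess xᵀ l) 0 :=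
      Finset.sum_le_sum fun l _ => mul_le_mul_of_nonneg_left (le_max_left _ _) (h.nonneg p l)
    have h4 : ∑ l, x p l * max (excess xᵀ l) 0 ≤ 5 := by
      have : ∑ l, x p l * max (excess xᵀ l) 0
          ≤ ∑ l, (x p l + if 2 ≤ excess xᵀ l then (1 : ℤ) else 0) := by
        refine Finset.sum_le_sum fun l _ => ?_
        have := ht l
        rcases h.zero_or_one p l with e | e <;> rw [e] <;> split_ifs <;> omega
      rw [Finset.sum_add_distrib, sum_row] at this
      linarith
    have h5 : ∑ l, (1 - x p l) * max (excess xᵀ l) 0 ≤ 1 := by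
      have h6 : ∑ l, (1 - x p l) * max (excess xᵀ l) 0
          ≤ ∑ l, if x p l = 0 ∧ 1 ≤ excess xᵀ l then (1 : ℤ) else 0 := by
        refine Finset.sum_le_sum fun l _ => ?_
        rcases h.zero_or_one p l with e | e
        · have := h.sub_le_deficiency e
          rw [e]; split_ifs <;> omega
        · simp [e]
      rw [Finset.sum_boole] at h6
      have : #{l | x p l = 0 ∧ 1 ≤ excess xᵀ l} ≤ 1 := Finset.card_le_one.2 fun a ha b hb => by
        simp only [Finset.mem_filter, Finset.mem_univ, true_and] at ha hb
        by_contra hab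
        have := h.sub_add_sub_le_deficiency hab ha.1 hb.1
        omega
      exact h6.trans (by exact_mod_cast this)
    simp only [sub_mul, one_mul, Finset.sum_sub_distrib, h.transpose.sum_max_excess] at h5
    linarith
  have h1 := Finset.sum_le_sum fun p (_ : p ∈ univ) => key p
  rw [Finset.sum_add_distrib, Finset.sum_sub_distrib, h.sum_const, h.sum_excess,
    h.sum_deficiency] at h1
  change _ + shortfall x ≤ _ at h1
  have h2 := h.transpose.shortfall_le_sum_sq
  have h3 := h.transpose.shortfall_lt
  rw [Matrix.transpose_transpose] at h3
  linarith

theorem excess_le_one (h : Overfull x) (p : ι) : excess x p ≤ 1 := by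
  have h1 := h.excess_le_shortfall p
  have h2 := h.shortfall_transpose_le_five
  omega

theorem two_le_shortfall (h : Overfull x) : 2 ≤ shortfall xᵀ := by
  obtain ⟨p, hp⟩ := h.exists_excess_pos
  linarith [h.excess_le_shortfall p]

theorem exists_excess_neg (h : Overfull x) : ∃ p, excess x p < 0 := by
  by_contra! hc
  have h1 := h.transpose.two_le_shortfall
  rw [Matrix.transpose_transpose, shortfall,
    Finset.sum_eq_zero fun p _ => max_eq_right (by linarith [hc p])] at h1
  omega

/-- If the column shortfall is only two, rows of positive excess meet every column of negative
excess. -/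
theorem apply_eq_one_of_shortfall (h : Overfull x) (hN : shortfall xᵀ ≤ 2) {p l : ι}
    (hp : 1 ≤ excess x p) (hl : excess xᵀ l < 0) : x p l = 1 := by
  refine (h.zero_or_one p l).resolve_left fun e => ?_
  have h1 := h.excess_le_sum_neg p
  have h2 : ∑ m, x p m * max (-excess xᵀ m) 0 < shortfall xᵀ := by
    refine Finset.sum_lt_sum (fun m _ => ?_) ⟨l, Finset.mem_univ l, ?_⟩
    · nlinarith [h.le_one p m, le_max_right (-excess xᵀ m) 0]
    · rw [e, zero_mul]; exact lt_max_of_lt_left (by omega)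
  omega

theorem shortfall_le_two (h : Overfull x) (hN : shortfall xᵀ ≤ 2) : shortfall x ≤ 2 := by
  classical
  obtain ⟨l, hl⟩ := h.transpose.exists_excess_neg
  have key : ∀ m, excess xᵀ m < 0 → ∀ p, max (excess x p) 0 ≤ x p m := fun m hm p => by
    have := h.excess_le_one p
    rcases le_or_gt 1 (excess x p) with e | e
    · rw [h.apply_eq_one_of_shortfall hN e hm]; omega
    · have := h.nonneg p m; omega
  have h1 := Finset.sum_le_sum fun p (_ : p ∈ univ) => key l hl p
  rw [h.sum_max_excess, sum_col] at h1
  by_contra! hn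
  have hl1 : excess xᵀ l = -1 := by omega
  obtain ⟨m, hm, hml⟩ : ∃ m, excess xᵀ m < 0 ∧ l ≠ m := by
    by_contra! hc
    have h2 := h.two_le_shortfall
    rw [shortfall, Finset.sum_eq_single_of_mem l (Finset.mem_univ l)] at h2
    · omega
    · intro m _ hne
      have : 0 ≤ excess xᵀ m := by
        by_contra! hm
        exact hne (hc m hm).symm
      omega
  have h3 : ∑ p, max (excess x p) 0 ≤ ∑ p, x p l * x p m := by
    refine Finset.sum_le_sum fun p _ => ?_
    have h4 := key l hl p
    have h5 := key m hm p
    rcases h.zero_or_one p l with e | e <;> rw [e] at h4 ⊢ <;> linarith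
  rw [h.sum_max_excess] at h3
  linarith [h.col_inner l m hml]

/-- A row of excess zero and deficiency one is disjoint from a row meeting all the columns of
positive excess that it misses. -/
theorem exists_disjoint_row (h : Overfull x) {p : ι} (hp : excess x p = 0)
    (hd : deficiency x p = 1) :
    ∃ q, (∀ l, x p l = 1 → x q l = 0) ∧ ∀ l, 1 ≤ excess xᵀ l → x p l = 0 → x q l = 1 := by
  classical
  have hsum := (h.deficiency_eq p).symm.trans hd
  have hdisj : ∀ {q}, ∑ m, x p m * x q m = 0 → ∀ l, x p l = 1 → x q l = 0 := fun {q} hq l hl => by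
    have := (Finset.sum_eq_zero_iff_of_nonneg fun m _ => mul_nonneg (h.nonneg p m)
      (h.nonneg q m)).1 hq l (Finset.mem_univ l)
    rwa [hl, one_mul] at this
  obtain ⟨q, hq, hq1⟩ : ∃ q ∈ univ.erase p, 1 - ∑ m, x p m * x q m ≠ 0 :=
    Finset.exists_ne_zero_of_sum_ne_zero (by rw [hsum]; norm_num)
  have hq0 : ∑ m, x p m * x q m = 0 := by
    have := h.disjoint_nonneg hq
    have := h.inner_nonneg p q
    omega
  refine ⟨q, hdisj hq0, fun l hl hpl => ?_⟩
  have h1 := h.sub_le_sum_disjoint hpl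
  obtain ⟨r, -, hr⟩ : ∃ r ∈ univ, 0 < x r l * (1 - ∑ m, x p m * x r m) := by
    by_contra! hc
    have := Finset.sum_nonpos hc
    omega
  have hrl : x r l = 1 := (h.zero_or_one r l).resolve_left fun e => by simp [e] at hr
  have hrp : r ≠ p := by rintro rfl; omega
  have hr0 : ∑ m, x p m * x r m = 0 := by
    rw [hrl] at hr
    have := h.inner_nonneg p r
    omega
  by_cases hrq : r = q
  · rwa [← hrq]
  have h2 : ∑ k ∈ {r, q}, (1 - ∑ m, x p m * x k m) ≤ 1 := by
    refine le_trans (Finset.sum_le_sum_of_subset_of_nonneg ?_ fun k hk _ => h.disjoint_nonneg hk)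
      hsum.le
    intro k hk
    rcases Finset.mem_insert.1 hk with rfl | hk
    · simp [hrp]
    · rwa [Finset.mem_singleton.1 hk]
  rw [Finset.sum_pair hrq, hr0, hq0] at h2
  omega

/-- The number of columns of positive excess that meet row `p` is at least `colExcess x p`. -/
theorem colExcess_le (h : Overfull x) (p : ι) :
    colExcess x p ≤ ∑ l with 1 ≤ excess xᵀ l, x p l := by
  rw [Finset.sum_filter]
  refine Finset.sum_le_sum fun l _ => ?_
  have := h.transpose.excess_le_one l
  rcases h.zero_or_one p l with e | e <;> rw [e] <;> split_ifs <;> omega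

theorem card_excess_pos (h : Overfull x) :
    (#{p | 1 ≤ excess x p} : ℤ) = 1 + shortfall x := by
  rw [← h.sum_max_excess, ← Finset.sum_boole]
  refine Finset.sum_congr rfl fun p _ => ?_
  have := h.excess_le_one p
  split_ifs <;> omega

theorem card_excess_neg_le : (#{p | excess x p < 0} : ℤ) ≤ shortfall x := by
  rw [← Finset.sum_boole]
  refine Finset.sum_le_sum fun p _ => ?_
  split_ifs <;> omega

/-- Pairs of columns in a set `H` are covered at most once by the rows. -/
theorem sum_pairs_le (h : Overfull x) (H : Finset ι) :
    ∑ p, (∑ l ∈ H, x p l) * (∑ l ∈ H, x p l - 1) ≤ #H * (#H - 1) := by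
  classical
  have h1 : ∑ p, (∑ l ∈ H, x p l) * (∑ l ∈ H, x p l) = ∑ l ∈ H, ∑ m ∈ H, ∑ p, x p l * x p m := by
    simp_rw [Finset.sum_mul_sum]
    rw [Finset.sum_comm]
    exact Finset.sum_congr rfl fun l _ => Finset.sum_comm
  have h2 : ∀ l ∈ H, ∑ m ∈ H, ∑ p, x p l * x p m ≤ ∑ p, x p l + (#H - 1) := fun l hl => by
    rw [← Finset.add_sum_erase H _ hl]
    refine add_le_add (Finset.sum_le_sum fun p _ => (h.mul_self_eq p l).le) ?_
    have h3 := Finset.sum_le_card_nsmul (H.erase l) (fun m => ∑ p, x p l * x p m) 1 fun m hm =>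
      h.col_inner l m (Finset.ne_of_mem_erase hm).symm
    have h4 := Finset.card_erase_add_one hl
    simp only [nsmul_eq_mul, mul_one] at h3
    omega
  have h5 := Finset.sum_le_sum h2
  rw [← h1, Finset.sum_add_distrib, Finset.sum_comm, Finset.sum_const, nsmul_eq_mul] at h5
  simp_rw [mul_sub, mul_one] at h5 ⊢
  rw [Finset.sum_sub_distrib]
  linarith

theorem card_le_of_meets_once (h : Overfull x) {p : ι} (hp : excess x p = 0)
    (hd : deficiency x p = 1) (hone : ∑ l with 1 ≤ excess xᵀ l, x p l = 1) :
    3 ≤ shortfall xᵀ ∧ #{q | excess x q = 0 ∧ deficiency x q = 1} ≤ 7 := by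
  classical
  set H : Finset ι := {l | 1 ≤ excess xᵀ l} with hH
  have hcard : (#H : ℤ) = 1 + shortfall xᵀ := h.transpose.card_excess_pos
  have hN := h.two_le_shortfall
  obtain ⟨l, hl, hl1⟩ : ∃ l ∈ H, x p l ≠ 0 :=
    Finset.exists_ne_zero_of_sum_ne_zero (by rw [hone]; norm_num)
  have hpl : x p l = 1 := (h.zero_or_one p l).resolve_left hl1
  have hpoff : ∀ m ∈ H.erase l, x p m = 0 := by
    rw [← Finset.add_sum_erase H _ hl, hpl] at hone
    exact (Finset.sum_eq_zero_iff_of_nonneg fun m _ => h.nonneg p m).1 (by linarith)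
  obtain ⟨q, hq, hq1⟩ := h.exists_disjoint_row hp hd
  have hql := hq l hpl
  have hqH : ∀ m ∈ H, m ≠ l → x q m = 1 := fun m hm hml =>
    hq1 m (by simpa [hH] using hm) (hpoff m (Finset.mem_erase.2 ⟨hml, hm⟩))
  have h3 : 3 ≤ shortfall xᵀ := by
    by_contra! hlt
    have hn := h.shortfall_le_two (by omega)
    obtain ⟨r, hr⟩ := h.exists_excess_neg
    have hrH : ∀ m ∈ H, x r m = 1 := fun m hm =>
      h.transpose.apply_eq_one_of_shortfall hn (by simpa [hH] using hm) hr
    have hc : 1 < #(H.erase l) := by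
      have := Finset.card_erase_add_one hl; omega
    obtain ⟨a, ha, b, hb, hab⟩ := Finset.one_lt_card.1 hc
    rw [Finset.mem_erase] at ha hb
    have := h.eq_of_common hab (hrH a ha.2) (hrH b hb.2) (hqH a ha.2 ha.1) (hqH b hb.2 hb.1)
    have := hrH l hl
    simp_all
  refine ⟨h3, ?_⟩
  have hsub : ({r | excess x r = 0 ∧ deficiency x r = 1} : Finset ι)
      ⊆ insert q ({r | x r l = 1} : Finset ι) := by
    intro r hr
    simp only [Finset.mem_filter, Finset.mem_univ, true_and, Finset.mem_insert] at hr ⊢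
    by_contra! hc
    obtain ⟨hrq, hrl⟩ := hc
    have hrl := (h.zero_or_one r l).resolve_right hrl
    obtain ⟨m, hm, hm1⟩ : ∃ m ∈ H, x r m ≠ 0 := by
      refine Finset.exists_ne_zero_of_sum_ne_zero fun e => ?_
      have h4 := h.colExcess_le r
      have h5 := colExcess_add_deficiency (x := x) r
      rw [e] at h4
      omega
    have hrm := (h.zero_or_one r m).resolve_left hm1
    have hml : m ≠ l := by rintro rfl; omega
    obtain ⟨k, -, hk⟩ := h.exists_disjoint_row hr.1 hr.2
    have hkH : ∀ a ∈ (H.erase l).erase m, x q a = 1 ∧ x k a = 1 := fun a ha => by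
      simp only [Finset.mem_erase] at ha
      have hqa := hqH a ha.2.2 ha.2.1
      refine ⟨hqa, hk a (by simpa [hH] using ha.2.2) ?_⟩
      refine (h.zero_or_one r a).resolve_right fun hra => hrq ?_
      exact h.eq_of_common ha.1 hra hrm hqa (hqH m hm hml)
    have hc : 1 < #((H.erase l).erase m) := by
      have h4 := Finset.card_erase_add_one hl
      have h5 := Finset.card_erase_add_one (Finset.mem_erase.2 ⟨hml, hm⟩)
      omega
    obtain ⟨a, ha, b, hb, hab⟩ := Finset.one_lt_card.1 hc
    have hqk := h.eq_of_common hab (hkH a ha).1 (hkH b hb).1 (hkH a ha).2 (hkH b hb).2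
    have := hk l (by simpa [hH] using hl) hrl
    rw [← hqk] at this
    omega
  have h4 := (Finset.card_le_card hsub).trans (Finset.card_insert_le _ _)
  have h5 : (#{r | x r l = 1} : ℤ) = 5 + excess xᵀ l := by
    rw [← sum_col, ← Finset.sum_boole]
    refine Finset.sum_congr rfl fun r _ => ?_
    rcases h.zero_or_one r l with e | e <;> simp [e]
  have h6 := h.transpose.excess_le_one l
  omega

theorem not_overfull (x : Matrix ι ι ℤ) : ¬ Overfull x := by
  classical
  intro h
  set H : Finset ι := {l | 1 ≤ excess xᵀ l} with hH
  set Z : Finset ι := {p | excess x p = 0 ∧ deficiency x p = 1} with hZ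
  set Q : Finset ι := {p | excess x p < 0} with hQ
  have hcard : (#H : ℤ) = 1 + shortfall xᵀ := h.transpose.card_excess_pos
  have hpairs := h.sum_pairs_le H
  have hQn : (#Q : ℤ) ≤ shortfall x := card_excess_neg_le
  have hlow := h.two_le_shortfall
  have hup := h.shortfall_transpose_le_five
  have hn : 0 ≤ shortfall x := Finset.sum_nonneg fun p _ => le_max_right _ _
  have hT : ∀ p, colExcess x p ≤ ∑ l ∈ H, x p l := h.colExcess_le
  have hmany : 8 + 2 * shortfall x + 2 * shortfall xᵀ ≤ #Z + ∑ p ∈ Q, ∑ l ∈ H, x p l := by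
    have key : ∀ p, 2 - 2 * max (excess x p) 0 + 4 * max (-excess x p) 0
        - (if excess x p = 0 ∧ deficiency x p = 1 then 1 else 0)
        - (if excess x p < 0 then ∑ l ∈ H, x p l else 0) ≤ deficiency x p := fun p => by
      have h1 := h.excess_le_one p
      have h2 := h.deficiency_nonneg p
      have h3 := h.one_sub_excess_le_deficiency p
      have h4 := colExcess_add_deficiency (x := x) p
      have h5 := hT p
      split_ifs <;> omega
    have h1 := Finset.sum_le_sum fun p (_ : p ∈ univ) => key p
    rw [Finset.sum_sub_distrib, Finset.sum_sub_distrib, Finset.sum_add_distrib,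
      Finset.sum_sub_distrib, h.sum_const, ← Finset.mul_sum, ← Finset.mul_sum, h.sum_max_excess,
      Finset.sum_boole, ← Finset.sum_filter, h.sum_deficiency] at h1
    change 23 * 2 - 2 * (1 + shortfall x) + 4 * shortfall x - (#Z : ℤ) - ∑ p ∈ Q, _ ≤ _ at h1
    linarith [h.transpose.shortfall_le_sum_sq]
  have hpairs_subset : ∀ W : Finset ι, ∑ p ∈ W, (∑ l ∈ H, x p l) * (∑ l ∈ H, x p l - 1)
      ≤ (1 + shortfall xᵀ) * shortfall xᵀ := fun W => by
    rw [hcard, add_sub_cancel_left] at hpairs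
    refine le_trans (Finset.sum_le_sum_of_subset_of_nonneg (Finset.subset_univ _) fun p _ _ => ?_)
      hpairs
    linarith [Int.le_self_sq (∑ l ∈ H, x p l)]
  have hQpairs : 4 * ∑ p ∈ Q, ∑ l ∈ H, x p l - 6 * #Q
      ≤ ∑ p ∈ Q, (∑ l ∈ H, x p l) * (∑ l ∈ H, x p l - 1) := by
    have h1 : ∑ p ∈ Q, (4 * ∑ l ∈ H, x p l - 6)
        ≤ ∑ p ∈ Q, (∑ l ∈ H, x p l) * (∑ l ∈ H, x p l - 1) := by
      refine Finset.sum_le_sum fun p _ => ?_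
      linarith [Int.le_self_sq (∑ l ∈ H, x p l - 2)]
    rw [Finset.sum_sub_distrib, ← Finset.mul_sum, Finset.sum_const, nsmul_eq_mul] at h1
    linarith
  have hQle := hpairs_subset Q
  by_cases hA : ∀ p ∈ Z, 2 ≤ ∑ l ∈ H, x p l
  · have hZpairs : 2 * (#Z : ℤ) ≤ ∑ p ∈ Z, (∑ l ∈ H, x p l) * (∑ l ∈ H, x p l - 1) := by
      have h1 : ∑ p ∈ Z, (2 : ℤ) ≤ ∑ p ∈ Z, (∑ l ∈ H, x p l) * (∑ l ∈ H, x p l - 1) :=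
        Finset.sum_le_sum fun p hp => by nlinarith [hA p hp]
      rw [Finset.sum_const, nsmul_eq_mul] at h1
      linarith
    have hdisj : Disjoint Z Q := Finset.disjoint_filter.2 fun p _ hz => by omega
    have hZle := hpairs_subset Z
    have hZQ := hpairs_subset (Z ∪ Q)
    rw [Finset.sum_union hdisj] at hZQ
    generalize shortfall xᵀ = N at *
    interval_cases N <;> omega
  · push Not at hA
    obtain ⟨p, hp, hp2⟩ := hA
    have hp' : excess x p = 0 ∧ deficiency x p = 1 := by simpa [hZ] using hp
    have h1 : ∑ l ∈ H, x p l = 1 := by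
      have := hT p
      have := colExcess_add_deficiency (x := x) p
      omega
    obtain ⟨h3, h7⟩ := h.card_le_of_meets_once hp'.1 hp'.2 h1
    have h7' : (#Z : ℤ) ≤ 7 := by exact_mod_cast h7
    generalize shortfall xᵀ = N at *
    interval_cases N <;> omega

end Overfull

/-- Two ones in common to two distinct rows form an all-one minor. -/
theorem Admissible.eq_of_common {m n : ℕ} {M : Fin m → Fin n → Bool} (hM : Admissible 2 2 M)
    {p q : Fin m} {i j : Fin n} (hij : i ≠ j) (hpi : M p i = true) (hpj : M p j = true)
    (hqi : M q i = true) (hqj : M q j = true) : p = q := by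
  by_contra hpq
  exact hM ⟨{p, q}, {i, j}, Finset.card_pair hpq, Finset.card_pair hij, by simp [*]⟩

theorem onesCount_le_of_admissible (M : Fin 23 → Fin 23 → Bool) (hM : Admissible 2 2 M) :
    onesCount M ≤ 115 := by
  by_contra! hlt
  obtain ⟨U, hU, hcard⟩ := Finset.exists_subset_card_eq (show 116 ≤ onesCount M from hlt)
  have hUM : ∀ {p l}, (p, l) ∈ U → M p l = true := fun hpl => by simpa using hU hpl
  refine Overfull.not_overfull (Matrix.of fun p l => if (p, l) ∈ U then (1 : ℤ) else 0)
    ⟨by simp, fun p l => ?_, fun p q hpq => ?_, fun l m hlm => ?_, ?_⟩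
  · by_cases h : (p, l) ∈ U <;> simp [h]
  · simp only [Matrix.of_apply, ← ite_and, mul_ite, mul_one, mul_zero, Finset.sum_boole]
    norm_cast
    refine Finset.card_le_one.2 fun a ha b hb => ?_
    simp only [Finset.mem_filter, Finset.mem_univ, true_and] at ha hb
    by_contra hab
    exact hpq (hM.eq_of_common hab (hUM ha.2) (hUM hb.2) (hUM ha.1) (hUM hb.1))
  · simp only [Matrix.of_apply, ← ite_and, mul_ite, mul_one, mul_zero, Finset.sum_boole]
    norm_cast
    refine Finset.card_le_one.2 fun a ha b hb => ?_
    simp only [Finset.mem_filter, Finset.mem_univ, true_and] at ha hb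
    exact hM.eq_of_common hlm (hUM ha.2) (hUM ha.1) (hUM hb.2) (hUM hb.1)
  · simp only [Matrix.of_apply]
    rw [← Fintype.sum_prod_type' (f := fun p l => if (p, l) ∈ U then (1 : ℤ) else 0)]
    simp [hcard]

theorem sub_eq_sub_of_mem : ∀ x ∈ ({0, 1, 3, 8, 14} : Finset (ZMod 23)),
    ∀ y ∈ ({0, 1, 3, 8, 14} : Finset (ZMod 23)), ∀ z ∈ ({0, 1, 3, 8, 14} : Finset (ZMod 23)),
    ∀ w ∈ ({0, 1, 3, 8, 14} : Finset (ZMod 23)), x ≠ y → x - y = z - w → x = z ∧ y = w := by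
  decide +kernel

/-- The circulant matrix of a set with distinct differences is admissible. -/
theorem admissible_circulant {n : ℕ} [NeZero n] {S : Finset (ZMod n)}
    (hS : ∀ x ∈ S, ∀ y ∈ S, ∀ z ∈ S, ∀ w ∈ S, x ≠ y → x - y = z - w → x = z ∧ y = w) :
    Admissible 2 2 (circulant n S) := by
  rintro ⟨R, C, hR, hC, h⟩
  obtain ⟨p, q, hpq, rfl⟩ := Finset.card_eq_two.1 hR
  obtain ⟨i, j, hij, rfl⟩ := Finset.card_eq_two.1 hC
  have hinj : ∀ {a b : Fin n}, ((a : ℕ) : ZMod n) = ((b : ℕ) : ZMod n) → a = b := fun {a b} e => by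
    rw [ZMod.natCast_eq_natCast_iff'] at e
    rw [Nat.mod_eq_of_lt a.2, Nat.mod_eq_of_lt b.2] at e
    exact Fin.ext e
  simp only [circulant, decide_eq_true_eq, Finset.mem_insert, Finset.mem_singleton,
    forall_eq_or_imp, forall_eq] at h
  obtain ⟨⟨hpi, hpj⟩, hqi, hqj⟩ := h
  have := hS _ hpi _ hpj _ hqi _ hqj (fun e => hij (hinj (sub_left_injective e))) (by ring)
  exact hpq (hinj (sub_right_injective this.1))

theorem onesCount_circulant :
    onesCount (circulant 23 ({0, 1, 3, 8, 14} : Finset (ZMod 23))) = 115 := by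
  decide +kernel

/-- `z_2(23) = 115`, and a maximal example is given by the circulant matrix of the set
`{0, 1, 3, 8, 14} ⊆ ℤ/23ℤ`, whose pairwise differences are all distinct. -/
theorem stmt16 :
    (∃ M : Fin 23 → Fin 23 → Bool, Admissible 2 2 M ∧ onesCount M = 115) ∧
      (∀ M : Fin 23 → Fin 23 → Bool, Admissible 2 2 M → onesCount M ≤ 115) ∧
      (∀ x y z w : ZMod 23, x ∈ ({0, 1, 3, 8, 14} : Finset (ZMod 23)) →
        y ∈ ({0, 1, 3, 8, 14} : Finset (ZMod 23)) →
        z ∈ ({0, 1, 3, 8, 14} : Finset (ZMod 23)) →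
        w ∈ ({0, 1, 3, 8, 14} : Finset (ZMod 23)) →
        x ≠ y → z ≠ w → x - y = z - w → x = z ∧ y = w) ∧
      Admissible 2 2 (circulant 23 ({0, 1, 3, 8, 14} : Finset (ZMod 23))) ∧
      onesCount (circulant 23 ({0, 1, 3, 8, 14} : Finset (ZMod 23))) = 115 := by
  have hadm := admissible_circulant sub_eq_sub_of_mem
  exact ⟨⟨_, hadm, onesCount_circulant⟩, onesCount_le_of_admissible,
    fun x y z w hx hy hz hw hxy _ => sub_eq_sub_of_mem x hx y hy z hz w hw hxy, hadm,
    onesCount_circulant⟩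
end

section
/- z_3(16) = 128: there exists a 16×16 (0,1)-matrix with 128 ones containing no all-one 3×3 minor, and every 16×16 (0,1)-matrix containing no all-one 3×3 minor has at most 128 ones. -/
/-- The number whose binary digits are the truth values of `P` along a list. -/
def bits {τ : Type} (P : τ → Bool) : List τ → ℕ
  | [] => 0
  | x :: l => cond (P x) 1 0 + 2 * bits P l

/-- All pairs of entries of a list, in the order of the list. -/
def comb2 {τ : Type} : List τ → List (τ × τ)
  | [] => []
  | x :: l => l.map (fun y => (x, y)) ++ comb2 l

/-- All triples of entries of a list, in the order of the list. -/
def comb3 {τ : Type} : List τ → List (τ × τ × τ)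
  | [] => []
  | x :: l => (comb2 l).map (fun y => (x, y)) ++ comb3 l

/-- The triples of row indices. -/
def rowTriples : List (ℕ × ℕ × ℕ) := comb3 (List.range 15)

/-- The triples of rows that avoid row `k`. -/
def avoid (k : ℕ) : ℕ :=
  bits (fun t => !(Nat.beq t.1 k || Nat.beq t.2.1 k || Nat.beq t.2.2 k)) rowTriples

/-- The triples of rows whose last entry is `k`. -/
def top (k : ℕ) : ℕ := bits (fun t => Nat.beq t.2.2 k) rowTriples

def meet (t : ℕ × ℕ × ℕ) : ℕ := Nat.land (Nat.land t.1 t.2.1) t.2.2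

/-- The triples of masks with at least one common point. -/
def once (c : List ℕ) : ℕ := bits (fun t => !Nat.beq (meet t) 0) (comb3 c)

/-- The triples of masks with at least two common points. -/
def twice (c : List ℕ) : ℕ :=
  bits (fun t => !Nat.beq (Nat.land (meet t) (meet t - 1)) 0) (comb3 c)

/-- Enumerate the admissible sets of rows of size at least `w`, each together with the bit set of
its triples of rows having a common point; recursors keep kernel evaluation fast. -/
noncomputable def gen (V w : ℕ) (l : List (ℕ × ℕ)) :
    ℕ → ℕ → ℕ → List (ℕ × ℕ) → List (ℕ × ℕ) :=
  List.rec (fun _ s U acc => Bool.rec acc ((s, U) :: acc) (Nat.ble w s))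
    (fun r _ ih n s U acc => Bool.rec acc
      (Bool.rec (ih (n - 1) s (Nat.land U r.1) acc)
        (ih (n - 1) (s + 1) U (ih (n - 1) s (Nat.land U r.1) acc))
        (Nat.beq (Nat.land (Nat.land U V) r.2) 0)) (Nat.ble w (s + n))) l

def rowData : List (ℕ × ℕ) := (List.range 15).map fun k => (avoid k, top k)

noncomputable def keep {τ : Type} (p : τ → Bool) (l : List τ) : List τ :=
  List.rec [] (fun a _ ih => Bool.rec ih (a :: ih) (p a)) l

noncomputable def join {τ : Type} (l l' : List τ) : List τ :=
  List.rec l' (fun a _ ih => a :: ih) l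

/-- The items of weight at most `n`, in order of decreasing weight. -/
noncomputable def byWeight (l : List (ℕ × ℕ)) (n : ℕ) : List (ℕ × ℕ) :=
  Nat.rec (keep (fun x => Nat.beq x.1 0) l)
    (fun n ih => join (keep (fun x => Nat.beq x.1 (n + 1)) l) ih) n

noncomputable def searchStep (f : ℕ → List (ℕ × ℕ) → Bool) (m need : ℕ) (l : List (ℕ × ℕ)) :
    Bool :=
  List.rec true
    (fun x l ih => Bool.rec true
      (Bool.rec false ih (f (need - x.1)
        (keep (fun y => Bool.rec false (Nat.beq (Nat.land x.2 y.2) 0)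
          (Nat.ble need (y.1 + m * x.1))) (x :: l))))
      (Nat.ble need ((m + 1) * x.1))) l

/-- Whether no `m` items with pairwise disjoint bit sets have total weight at least `need`. -/
noncomputable def search (m : ℕ) : ℕ → List (ℕ × ℕ) → Bool :=
  Nat.rec (fun need _ => !Nat.beq need 0) (fun m ih need l => searchStep ih m need l) m

/-- Whether no eight columns extend the rows with masks `c` by `need` further ones; columns with
fewer than `w` ones are relaxed to free columns with `w - 1` ones. -/
noncomputable def check (c : List ℕ) (w need : ℕ) : Bool :=
  search 8 need (join (byWeight (gen (twice c) w rowData 15 0 (once c) []) 15) [(w - 1, 0)])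

theorem keep_eq_filter {τ : Type} (p : τ → Bool) (l : List τ) : keep p l = l.filter p := by
  induction l with
  | nil => rfl
  | cons a l ih =>
    have h : keep p (a :: l) = Bool.rec (keep p l) (a :: keep p l) (p a) := rfl
    rw [h, ih]
    cases hp : p a <;> simp [hp]

theorem join_eq_append {τ : Type} (l l' : List τ) : join l l' = l ++ l' := by
  induction l with
  | nil => rfl
  | cons a l ih => exact congrArg (a :: ·) ih

theorem sum_le_length_mul (s : List (ℕ × ℕ)) (w : ℕ) (h : ∀ y ∈ s, y.1 ≤ w) :
    (s.map Prod.fst).sum ≤ s.length * w := by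
  have := List.sum_le_card_nsmul (s.map Prod.fst) w (by simpa using h)
  simpa using this

theorem search_sound (m need : ℕ) (l : List (ℕ × ℕ)) (hl : l.Pairwise fun x y => y.1 ≤ x.1)
    (h : search m need l = true) (s : List (ℕ × ℕ)) (hm : s.length = m) (hs : ∀ x ∈ s, x ∈ l)
    (hd : s.Pairwise fun x y => Nat.land x.2 y.2 = 0) : (s.map Prod.fst).sum < need := by
  induction m generalizing need l s with
  | zero =>
    have h' : (!Nat.beq need 0) = true := h
    rw [List.length_eq_zero_iff] at hm
    subst hm
    cases need with
    | zero => exact absurd h' (by decide)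
    | succ n => simp
  | succ m ihm =>
    have h' : searchStep (search m) m need l = true := h
    clear h
    induction l with
    | nil =>
      cases s with
      | nil => simp at hm
      | cons a s => exact absurd (hs a (by simp)) (by simp)
    | cons x l ihl =>
      have e : searchStep (search m) m need (x :: l) = Bool.rec true
        (Bool.rec false (searchStep (search m) m need l) (search m (need - x.1)
          (keep (fun y => Bool.rec false (Nat.beq (Nat.land x.2 y.2) 0)
            (Nat.ble need (y.1 + m * x.1))) (x :: l))))
        (Nat.ble need ((m + 1) * x.1)) := rfl
      rw [e] at h'
      have hle : ∀ y ∈ s, y.1 ≤ x.1 := by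
        intro y hy
        rcases List.mem_cons.1 (hs y hy) with rfl | hy'
        · exact le_rfl
        · exact (List.pairwise_cons.1 hl).1 y hy'
      cases hb : Nat.ble need ((m + 1) * x.1) with
      | false =>
        have h1 : ¬ need ≤ (m + 1) * x.1 := by
          intro h2
          rw [Nat.ble_eq_true_of_le h2] at hb
          exact absurd hb (by decide)
        have := sum_le_length_mul s x.1 hle
        rw [hm] at this
        omega
      | true =>
        rw [hb] at h'
        rw [keep_eq_filter] at h'
        cases hr : search m (need - x.1) ((x :: l).filter
          (fun y => Bool.rec false (Nat.beq (Nat.land x.2 y.2) 0)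
            (Nat.ble need (y.1 + m * x.1)))) with
        | false => rw [hr] at h'; exact (Bool.false_ne_true h').elim
        | true =>
          rw [hr] at h'
          by_cases hx : x ∈ s
          · obtain ⟨s', hp⟩ : ∃ s', s.Perm (x :: s') := ⟨_, List.perm_cons_erase hx⟩
            have hd' : (x :: s').Pairwise fun x y => Nat.land x.2 y.2 = 0 :=
              hp.pairwise hd (fun {a b} hab => by
                rw [show Nat.land b.2 a.2 = Nat.land a.2 b.2 from Nat.land_comm _ _]; exact hab)
            have hlen : s'.length = m := by
              have := hp.length_eq
              simp at this
              omega
            rw [(hp.map Prod.fst).sum_eq, List.map_cons, List.sum_cons]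
            by_cases hall : ∀ y ∈ s', need ≤ y.1 + m * x.1
            · have := ihm (need - x.1) _ (hl.sublist List.filter_sublist) hr s' hlen (by
                intro y hy
                rw [List.mem_filter]
                refine ⟨hs y (hp.mem_iff.2 (List.mem_cons_of_mem _ hy)), ?_⟩
                rw [Nat.ble_eq_true_of_le (hall y hy)]
                exact (Nat.beq_eq ▸ (List.pairwise_cons.1 hd').1 y hy : Nat.beq _ _ = true)) (List.pairwise_cons.1 hd').2
              omega
            · push Not at hall
              obtain ⟨y, hy, hlt⟩ := hall
              have hq := List.perm_cons_erase hy
              have h3 := sum_le_length_mul (s'.erase y) x.1 (fun z hz =>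
                hle z (hp.mem_iff.2 (List.mem_cons_of_mem _ (List.mem_of_mem_erase hz))))
              rw [(hq.map Prod.fst).sum_eq, List.map_cons, List.sum_cons]
              have h4 := hq.length_eq
              simp only [List.length_cons] at h4
              have h5 : m * x.1 = (s'.erase y).length * x.1 + x.1 := by
                rw [← hlen, h4]; ring
              omega
          · exact ihl (List.pairwise_cons.1 hl).2 (fun y hy => by
              rcases List.mem_cons.1 (hs y hy) with rfl | hy'
              · exact absurd hy hx
              · exact hy') h'

theorem byWeight_zero (l : List (ℕ × ℕ)) : byWeight l 0 = l.filter (fun x => Nat.beq x.1 0) :=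
  keep_eq_filter _ _

theorem byWeight_succ (l : List (ℕ × ℕ)) (n : ℕ) :
    byWeight l (n + 1) = l.filter (fun x => Nat.beq x.1 (n + 1)) ++ byWeight l n := by
  have h : byWeight l (n + 1) = join (keep (fun x => Nat.beq x.1 (n + 1)) l) (byWeight l n) := rfl
  rw [h, join_eq_append, keep_eq_filter]

theorem mem_byWeight (l : List (ℕ × ℕ)) (n : ℕ) (x : ℕ × ℕ) :
    x ∈ byWeight l n ↔ x ∈ l ∧ x.1 ≤ n := by
  induction n with
  | zero => simp [byWeight_zero]
  | succ n ih =>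
    rw [byWeight_succ, List.mem_append, List.mem_filter, ih, Nat.beq_eq]
    constructor
    · rintro (⟨h, e⟩ | ⟨h, e⟩)
      · exact ⟨h, e.le⟩
      · exact ⟨h, by omega⟩
    · rintro ⟨h, e⟩
      rcases Nat.lt_or_ge n x.1 with h1 | h1
      · exact Or.inl ⟨h, by omega⟩
      · exact Or.inr ⟨h, h1⟩

theorem byWeight_sorted (l : List (ℕ × ℕ)) (n : ℕ) :
    (byWeight l n).Pairwise fun x y => y.1 ≤ x.1 := by
  induction n with
  | zero =>
    rw [byWeight_zero]
    refine List.pairwise_of_forall_mem_list ?_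
    intro x hx y hy
    rw [List.mem_filter, Nat.beq_eq] at hx hy
    omega
  | succ n ih =>
    rw [byWeight_succ, List.pairwise_append]
    refine ⟨List.pairwise_of_forall_mem_list ?_, ih, ?_⟩
    · intro x hx y hy
      rw [List.mem_filter, Nat.beq_eq] at hx hy
      omega
    · intro x hx y hy
      rw [List.mem_filter, Nat.beq_eq] at hx
      rw [mem_byWeight] at hy
      omega

theorem testBit_bits {τ : Type} (P : τ → Bool) (l : List τ) (t : ℕ) :
    (bits P l).testBit t = true ↔ ∃ x, l[t]? = some x ∧ P x = true := by
  induction l generalizing t with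
  | nil => simp [bits]
  | cons a l ih =>
    cases t with
    | zero =>
      cases h : P a
      · simp [bits, h]
      · simp [bits, h]
    | succ t =>
      have h : (cond (P a) 1 0 + 2 * bits P l) / 2 = bits P l := by
        cases P a
        · simp
        · simp; omega
      rw [bits, Nat.testBit_succ, h, ih]
      simp

theorem comb2_map {σ τ : Type} (f : σ → τ) (l : List σ) :
    comb2 (l.map f) = (comb2 l).map (Prod.map f f) := by
  induction l with
  | nil => rfl
  | cons a l ih => simp [comb2, ih, Function.comp_def]

theorem comb3_map {σ τ : Type} (f : σ → τ) (l : List σ) :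
    comb3 (l.map f) = (comb3 l).map (Prod.map f (Prod.map f f)) := by
  induction l with
  | nil => rfl
  | cons a l ih => simp [comb3, ih, comb2_map, Function.comp_def]

theorem rowTriples_sorted : ∀ x ∈ rowTriples, x.1 < x.2.1 ∧ x.2.1 < x.2.2 ∧ x.2.2 < 15 := by
  decide +kernel

theorem testBit_avoid (k t : ℕ) : (avoid k).testBit t = true ↔
    ∃ x, rowTriples[t]? = some x ∧ x.1 ≠ k ∧ x.2.1 ≠ k ∧ x.2.2 ≠ k := by
  rw [avoid, testBit_bits]
  simp only [Bool.not_eq_true', Bool.or_eq_false_iff, and_assoc]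
  simp only [← Bool.not_eq_true, Nat.beq_eq, ne_eq]

theorem testBit_top (k t : ℕ) : (top k).testBit t = true ↔
    ∃ x, rowTriples[t]? = some x ∧ x.2.2 = k := by
  rw [top, testBit_bits]
  simp only [Nat.beq_eq]

theorem testBit_natLand (a b t : ℕ) :
    (Nat.land a b).testBit t = true ↔ a.testBit t = true ∧ b.testBit t = true := by
  rw [show Nat.land a b = a &&& b from rfl, Nat.testBit_and, Bool.and_eq_true]

theorem natLand_eq_zero {a b : ℕ} (h : ∀ t, a.testBit t = true → b.testBit t = true → False) :
    Nat.land a b = 0 := by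
  refine Nat.eq_of_testBit_eq fun t => ?_
  rw [Nat.zero_testBit, ← Bool.not_eq_true, testBit_natLand]
  exact fun ht => h t ht.1 ht.2

theorem gen_cons (V w : ℕ) (r : ℕ × ℕ) (l : List (ℕ × ℕ)) (n s U : ℕ) (acc : List (ℕ × ℕ)) :
    gen V w (r :: l) n s U acc = if w ≤ s + n then
      if Nat.land (Nat.land U V) r.2 = 0 then
        gen V w l (n - 1) (s + 1) U (gen V w l (n - 1) s (Nat.land U r.1) acc)
      else gen V w l (n - 1) s (Nat.land U r.1) acc
    else acc := by
  have h : gen V w (r :: l) n s U acc = Bool.rec acc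
      (Bool.rec (gen V w l (n - 1) s (Nat.land U r.1) acc)
        (gen V w l (n - 1) (s + 1) U (gen V w l (n - 1) s (Nat.land U r.1) acc))
        (Nat.beq (Nat.land (Nat.land U V) r.2) 0)) (Nat.ble w (s + n)) := rfl
  rw [h]
  simp only [← Nat.ble_eq, ← Nat.beq_eq]
  cases Nat.ble w (s + n) <;> cases Nat.beq (Nat.land (Nat.land U V) r.2) 0 <;> simp

theorem gen_nil (V w n s U : ℕ) (acc : List (ℕ × ℕ)) :
    gen V w [] n s U acc = if w ≤ s then (s, U) :: acc else acc := by
  have h : gen V w [] n s U acc = Bool.rec acc ((s, U) :: acc) (Nat.ble w s) := rfl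
  rw [h]
  simp only [← Nat.ble_eq]
  cases Nat.ble w s <;> simp

theorem subset_gen (V w : ℕ) (l : List (ℕ × ℕ)) (n s U : ℕ) (acc : List (ℕ × ℕ)) :
    acc ⊆ gen V w l n s U acc := by
  induction l generalizing n s U acc with
  | nil => rw [gen_nil]; split_ifs <;> simp
  | cons r l ih =>
    rw [gen_cons]
    split_ifs
    · exact List.Subset.trans (ih _ _ _ _) (ih _ _ _ _)
    · exact ih _ _ _ _
    · exact List.Subset.refl _

theorem le_of_mem_gen (V w : ℕ) (l : List (ℕ × ℕ)) (n s U : ℕ) (acc : List (ℕ × ℕ))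
    (hacc : ∀ x ∈ acc, w ≤ x.1) : ∀ x ∈ gen V w l n s U acc, w ≤ x.1 := by
  induction l generalizing n s U acc with
  | nil =>
    rw [gen_nil]
    split_ifs with h
    · intro x hx
      rcases List.mem_cons.1 hx with rfl | hx
      · exact h
      · exact hacc x hx
    · exact hacc
  | cons r l ih =>
    rw [gen_cons]
    split_ifs
    · exact ih _ _ _ _ (ih _ _ _ _ hacc)
    · exact ih _ _ _ _ hacc
    · exact hacc

theorem exists_mem_gen (V w : ℕ) (p : ℕ → Prop) [DecidablePred p]
    (hV : ∀ t x, rowTriples[t]? = some x → V.testBit t = true → ¬(p x.1 ∧ p x.2.1 ∧ p x.2.2))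
    (n a s U : ℕ) (acc : List (ℕ × ℕ)) (ha : a + n = 15)
    (hU : ∀ t x, rowTriples[t]? = some x → U.testBit t = true →
      (x.1 < a → p x.1) ∧ (x.2.1 < a → p x.2.1) ∧ (x.2.2 < a → p x.2.2))
    (hw : w ≤ s + ((List.range' a n).filter p).length) :
    ∃ U', (s + ((List.range' a n).filter p).length, U') ∈
        gen V w ((List.range' a n).map fun k => (avoid k, top k)) n s U acc ∧
      ∀ t, U'.testBit t = true → U.testBit t = true ∧
        ∀ x, rowTriples[t]? = some x → p x.1 ∧ p x.2.1 ∧ p x.2.2 := by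
  have hlt : ∀ {t : ℕ} {x : ℕ × ℕ × ℕ}, rowTriples[t]? = some x → x.1 < x.2.1 ∧ x.2.1 < x.2.2 ∧ x.2.2 < 15 :=
    fun h => rowTriples_sorted _ (List.mem_of_getElem? h)
  induction n generalizing a s U acc with
  | zero =>
    refine ⟨U, ?_, fun t ht => ⟨ht, fun x hx => ?_⟩⟩
    · simp at hw
      simp [gen_nil, hw]
    · have h1 := hU t x hx ht
      have h2 := hlt hx
      exact ⟨h1.1 (by omega), h1.2.1 (by omega), h1.2.2 (by omega)⟩
  | succ n ih =>
    have hlen : ((List.range' (a + 1) n).filter p).length ≤ n :=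
      (List.length_filter_le _ _).trans (by simp)
    rw [List.range'_succ] at hw ⊢
    rw [List.map_cons, gen_cons]
    by_cases hp : p a
    · rw [List.filter_cons_of_pos (by simpa using hp), List.length_cons] at hw ⊢
      rw [if_pos (by omega), if_pos ?_]
      · have hs : s + (((List.range' (a + 1) n).filter p).length + 1) =
            s + 1 + ((List.range' (a + 1) n).filter p).length := by omega
        rw [hs] at hw ⊢
        refine ih (a + 1) (s + 1) U _ (by omega) (fun t x hx ht => ?_) hw
        have h1 := hU t x hx ht
        have key : ∀ y, (y < a → p y) → y < a + 1 → p y := by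
          intro y h2 h3
          rcases Nat.lt_succ_iff_lt_or_eq.1 h3 with h4 | rfl
          · exact h2 h4
          · exact hp
        exact ⟨key _ h1.1, key _ h1.2.1, key _ h1.2.2⟩
      · refine natLand_eq_zero fun t h1 h2 => ?_
        rw [testBit_natLand] at h1
        obtain ⟨x, hx, rfl⟩ := (testBit_top a t).1 h2
        have h3 := hU t x hx h1.1
        have h4 := hlt hx
        exact hV t x hx h1.2 ⟨h3.1 (by omega), h3.2.1 (by omega), hp⟩
    · rw [List.filter_cons_of_neg (by simpa using hp)] at hw ⊢
      rw [if_pos (by omega)]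
      obtain ⟨U', h1, h2⟩ := ih (a + 1) s (Nat.land U (avoid a)) acc (by omega)
        (fun t x hx ht => by
          rw [testBit_natLand] at ht
          have h1 := hU t x hx ht.1
          obtain ⟨y, hy, h2⟩ := (testBit_avoid a t).1 ht.2
          rw [hx, Option.some.injEq] at hy
          subst hy
          exact ⟨fun h => h1.1 (by omega), fun h => h1.2.1 (by omega),
            fun h => h1.2.2 (by omega)⟩) hw
      refine ⟨U', ?_, fun t ht => ?_⟩
      · split_ifs
        · exact subset_gen _ _ _ _ _ _ _ h1
        · exact h1
      · have h3 := h2 t ht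
        rw [testBit_natLand] at h3
        exact ⟨h3.1.1, h3.2⟩

theorem card_eq_length_filter (S : Finset (Fin 15)) :
    ((List.range' 0 15).filter fun i => ∃ h : i < 15, (⟨i, h⟩ : Fin 15) ∈ S).length = S.card := by
  rw [← List.range_eq_range', ← Multiset.coe_card, ← Multiset.filter_coe]
  have h : S.card = (S.map Fin.valEmbedding).card := (Finset.card_map _).symm
  rw [h]
  have h2 : S.map Fin.valEmbedding =
      (Finset.range 15).filter fun i => ∃ h : i < 15, (⟨i, h⟩ : Fin 15) ∈ S := by
    ext i
    simp only [Finset.mem_map, Fin.valEmbedding_apply, Finset.mem_filter, Finset.mem_range]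
    constructor
    · rintro ⟨a, ha, rfl⟩
      exact ⟨a.2, a.2, ha⟩
    · rintro ⟨_, h, hi⟩
      exact ⟨⟨i, h⟩, hi, rfl⟩
  rw [h2]
  rfl

theorem check_sound (c : List ℕ) (hc : c.length = 15) (w need : ℕ)
    (h : check c w need = true) (R : Fin 8 → Finset (Fin 15))
    (h1 : ∀ a b d : Fin 15, a < b → b < d → meet (c.getD a 0, c.getD b 0, c.getD d 0) ≠ 0 →
      ∀ j j', j ≠ j' → a ∈ R j → b ∈ R j → d ∈ R j → a ∈ R j' → b ∈ R j' → d ∉ R j')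
    (h2 : ∀ a b d : Fin 15, a < b → b < d →
      Nat.land (meet (c.getD a 0, c.getD b 0, c.getD d 0)) (meet (c.getD a 0, c.getD b 0, c.getD d 0) - 1) ≠ 0 →
      ∀ j, a ∈ R j → b ∈ R j → d ∉ R j) :
    ∑ j, (R j).card < need := by
  have hc' : c = (List.range 15).map fun i => c.getD i 0 := by
    refine List.ext_getElem (by simp [hc]) fun i hi _ => ?_
    simp [List.getD, hi]
  have htr : comb3 c = rowTriples.map
      (Prod.map (fun i => c.getD i 0) (Prod.map (fun i => c.getD i 0) fun i => c.getD i 0)) := by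
    conv_lhs => rw [hc']
    exact comb3_map _ _
  have hlt : ∀ {t : ℕ} {x : ℕ × ℕ × ℕ}, rowTriples[t]? = some x →
      x.1 < x.2.1 ∧ x.2.1 < x.2.2 ∧ x.2.2 < 15 :=
    fun h => rowTriples_sorted _ (List.mem_of_getElem? h)
  let p : Fin 8 → ℕ → Prop := fun j i => ∃ h : i < 15, (⟨i, h⟩ : Fin 15) ∈ R j
  have hitem : ∀ j, ∃ x : ℕ × ℕ,
      x ∈ byWeight (gen (twice c) w rowData 15 0 (once c) []) 15 ++ [(w - 1, 0)] ∧
      (R j).card ≤ x.1 ∧ ∀ t, x.2.testBit t = true → (once c).testBit t = true ∧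
        ∀ y, rowTriples[t]? = some y → p j y.1 ∧ p j y.2.1 ∧ p j y.2.2 := by
    intro j
    by_cases hwj : w ≤ (R j).card
    · obtain ⟨U, hU, hU'⟩ := exists_mem_gen (twice c) w (p j) (by
        intro t x hx hV hp
        rw [twice, testBit_bits, htr] at hV
        obtain ⟨y, hy, hV⟩ := hV
        rw [List.getElem?_map, hx, Option.map_some, Option.some.injEq] at hy
        subst hy
        obtain ⟨⟨q1, hp1⟩, ⟨q2, hp2⟩, ⟨q3, hp3⟩⟩ := hp
        have h3 := hlt hx
        refine h2 ⟨x.1, q1⟩ ⟨x.2.1, q2⟩ ⟨x.2.2, q3⟩ h3.1 h3.2.1 ?_ j hp1 hp2 hp3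
        intro h0
        simp only [Prod.map, Bool.not_eq_true', ← Bool.not_eq_true, Nat.beq_eq] at hV
        exact hV h0) 15 0 0 (once c) [] rfl (by
        intro t x _ _
        exact ⟨fun h => absurd h (by simp), fun h => absurd h (by simp),
          fun h => absurd h (by simp)⟩) (by
        rw [card_eq_length_filter]; omega)
      rw [card_eq_length_filter, Nat.zero_add] at hU
      refine ⟨((R j).card, U), List.mem_append_left _ ((mem_byWeight _ _ _).2 ⟨?_, ?_⟩), le_rfl, hU'⟩
      · rw [rowData, List.range_eq_range']
        exact hU
      · simpa using (R j).card_le_univ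
    · exact ⟨(w - 1, 0), by simp, by simp only; omega, fun t ht => by simp at ht⟩
  choose x hx hle hbit using hitem
  have hdisj : ∀ j j', j ≠ j' → Nat.land (x j).2 (x j').2 = 0 := by
    intro j j' hne
    refine natLand_eq_zero fun t ht ht' => ?_
    have ho := (hbit j t ht).1
    rw [once, testBit_bits, htr] at ho
    obtain ⟨z, hz, ho⟩ := ho
    rw [List.getElem?_map, Option.map_eq_some_iff] at hz
    obtain ⟨y, hy, rfl⟩ := hz
    have h3 := hlt hy
    obtain ⟨⟨q1, p1⟩, ⟨q2, p2⟩, ⟨q3, p3⟩⟩ := (hbit j t ht).2 y hy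
    obtain ⟨⟨_, p1'⟩, ⟨_, p2'⟩, ⟨_, p3'⟩⟩ := (hbit j' t ht').2 y hy
    refine h1 ⟨y.1, q1⟩ ⟨y.2.1, q2⟩ ⟨y.2.2, q3⟩ h3.1 h3.2.1 ?_ j j' hne p1 p2 p3 p1' p2' p3'
    intro h0
    simp only [Prod.map, Bool.not_eq_true', ← Bool.not_eq_true, Nat.beq_eq] at ho
    exact ho h0
  have hcheck : search 8 need
      (byWeight (gen (twice c) w rowData 15 0 (once c) []) 15 ++ [(w - 1, 0)]) = true := by
    rw [← join_eq_append]
    exact h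
  have hs := search_sound 8 need _ (by
    rw [List.pairwise_append]
    refine ⟨byWeight_sorted _ _, List.pairwise_singleton _ _, fun a ha b hb => ?_⟩
    rw [List.mem_singleton] at hb
    subst hb
    have := le_of_mem_gen _ _ _ _ _ _ _ (by simp) a ((mem_byWeight _ _ _).1 ha).1
    simp only
    omega) hcheck (List.ofFn x) (by simp) (by
    intro y hy
    obtain ⟨j, rfl⟩ := List.mem_ofFn.1 hy
    exact hx j) (by
    rw [List.pairwise_ofFn]
    exact fun i j hij => hdisj i j hij.ne)
  rw [List.map_ofFn, List.sum_ofFn] at hs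
  exact (Finset.sum_le_sum fun j _ => hle j).trans_lt hs

/-- The number of ones among the last eight binary digits. -/
def pop (z : ℕ) : ℕ := (List.range 8).countP fun i => z.testBit i

/-- The mask obtained by relabelling the points along the list `h`. -/
def pull (h : List ℕ) (z : ℕ) : ℕ := bits (fun i => z.testBit i) h

theorem testBit_pull (h : List ℕ) (z i : ℕ) :
    (pull h z).testBit i = true ↔ ∃ x, h[i]? = some x ∧ z.testBit x = true :=
  testBit_bits _ _ _

theorem pull_land (h : List ℕ) (a b : ℕ) : pull h (a &&& b) = pull h a &&& pull h b := by
  refine Nat.eq_of_testBit_eq fun i => ?_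
  rw [Bool.eq_iff_iff, Nat.testBit_and, Bool.and_eq_true, testBit_pull, testBit_pull, testBit_pull]
  constructor
  · rintro ⟨x, hx, h1⟩
    rw [Nat.testBit_and, Bool.and_eq_true] at h1
    exact ⟨⟨x, hx, h1.1⟩, ⟨x, hx, h1.2⟩⟩
  · rintro ⟨⟨x, hx, h1⟩, ⟨y, hy, h2⟩⟩
    rw [hx, Option.some.injEq] at hy
    subst hy
    exact ⟨x, hx, by rw [Nat.testBit_and, h1, h2]; rfl⟩

theorem bits_lt {τ : Type} (P : τ → Bool) (l : List τ) : bits P l < 2 ^ l.length := by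
  induction l with
  | nil => simp [bits]
  | cons a l ih =>
    rw [bits, List.length_cons, pow_succ]
    cases P a
    · simp only [cond_false]; omega
    · simp only [cond_true]; omega

theorem pull_lt {h : List ℕ} (hh : h.Perm (List.range 8)) (z : ℕ) : pull h z < 256 := by
  have h1 := bits_lt (fun i => z.testBit i) h
  rwa [hh.length_eq, List.length_range] at h1

theorem pop_pull {h : List ℕ} (hh : h.Perm (List.range 8)) (z : ℕ) : pop (pull h z) = pop z := by
  have hl : h.length = 8 := by simpa using hh.length_eq
  have h1 : h = (List.range 8).map fun i => h.getD i 0 := by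
    refine List.ext_getElem (by simp [hl]) fun i hi _ => ?_
    simp [List.getD, hi]
  rw [pop, pop, ← hh.countP_eq (fun i => z.testBit i), h1, List.countP_map, ← h1]
  refine List.countP_congr fun i hi => ?_
  rw [List.mem_range] at hi
  have hi' : i < h.length := by omega
  rw [testBit_pull]
  simp [List.getD, hi']

theorem one_le_pop : ∀ z < 256, z ≠ 0 → 1 ≤ pop z := by decide +kernel

theorem two_le_pop : ∀ z < 256, Nat.land z (z - 1) ≠ 0 → 2 ≤ pop z := by decide +kernel

/-- The planes of the affine space of dimension three over the field with two elements. -/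
def planes : List ℕ := [85, 170, 51, 204, 153, 102, 15, 240, 165, 90, 195, 60, 105, 150]

def tripleReps : List ((ℕ × ℕ × ℕ) × ℕ) :=
  [((195, 131, 193), 8), ((195, 67, 193), 7), ((195, 67, 194), 8), ((195, 67, 69), 8),
    ((51, 19, 69), 8), ((51, 35, 50), 8), ((51, 35, 69), 8), ((105, 41, 69), 8),
    ((15, 14, 21), 8), ((51, 50, 69), 8), ((51, 21, 81), 8), ((51, 69, 81), 8),
    ((204, 69, 76), 8), ((102, 38, 69), 7), ((204, 69, 81), 8), ((60, 52, 56), 8),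
    ((204, 76, 196), 8), ((60, 52, 69), 8), ((60, 44, 56), 8), ((60, 44, 69), 8),
    ((60, 44, 81), 8), ((204, 21, 81), 8), ((170, 21, 168), 8), ((170, 21, 69), 8),
    ((170, 42, 168), 8)]

set_option maxRecDepth 100000 in
theorem check_one : check (planes ++ [1]) 7 (121 - ((planes ++ [1]).map pop).sum) = true := by
  decide +kernel

set_option maxRecDepth 100000 in
theorem check_two : check (planes ++ [3]) 6 (121 - ((planes ++ [3]).map pop).sum) = true := by
  decide +kernel

set_option maxRecDepth 100000 in
theorem check_pair : ∀ s ∈ [3, 5, 6, 10, 20, 81], check (planes.erase 85 ++ [84, s]) 7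
    (121 - ((planes.erase 85 ++ [84, s]).map pop).sum) = true := by
  decide +kernel

set_option maxRecDepth 100000 in
theorem check_triple : ∀ x ∈ tripleReps, check ((planes.erase 85).erase x.1.1 ++
    [84, x.1.2.1, x.1.2.2]) x.2 (121 - (((planes.erase 85).erase x.1.1 ++
    [84, x.1.2.1, x.1.2.2]).map pop).sum) = true := by
  decide +kernel

/-- The sets of `n` among eight points. -/
def masks (n : ℕ) : List ℕ := (List.range 256).filter fun z => Nat.beq (pop z) n

theorem mem_masks {n z : ℕ} : z ∈ masks n ↔ z < 256 ∧ pop z = n := by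
  rw [masks, List.mem_filter, List.mem_range, Nat.beq_eq]

/-- The points of a mask. -/
def points (z : ℕ) : List ℕ := (List.range 8).filter fun i => z.testBit i

/-- A relabelling that moves the points of `q` to the front. -/
def front (q : ℕ) : List ℕ := points q ++ points (255 ^^^ q)

/-- A relabelling that fixes `15` and moves the quadruple `b` to standard position. -/
def frame (b : ℕ) : List ℕ :=
  points (15 &&& b) ++ points (15 ^^^ (15 &&& b)) ++ points (b ^^^ (15 &&& b)) ++
    points (255 ^^^ (15 ||| b))

/-- The affine map sending `0` to `p` with linear part mapping `1, 2, 4` to `a, b, c`. -/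
def affine (p a b c : ℕ) : List ℕ := (List.range 8).map fun x =>
  p ^^^ (cond (x.testBit 0) a 0) ^^^ (cond (x.testBit 1) b 0) ^^^ (cond (x.testBit 2) c 0)

/-- Affine maps that are transitive on points, on pairs and on triples. -/
def affs : List (List ℕ) := (List.range 8).flatMap fun p =>
  [(1, 2, 4), (2, 4, 3), (4, 3, 6), (3, 6, 7), (6, 7, 5), (7, 5, 1), (5, 1, 2)].map
    fun x => affine p x.1 x.2.1 x.2.2

/-- The linear maps that preserve the triple `84`. -/
def stabs : List (List ℕ) := [1, 3, 5, 7].flatMap fun a =>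
  [(2, 4), (4, 2), (2, 6), (6, 2), (4, 6), (6, 4)].map fun x => affine 0 a x.1 x.2

theorem perm_affs : ∀ h ∈ affs, h.Perm (List.range 8) ∧ ∀ z ∈ planes, pull h z ∈ planes := by
  decide +kernel

theorem perm_stabs : ∀ h ∈ stabs, h.Perm (List.range 8) ∧ pull h 84 = 84 ∧
    ∀ z ∈ planes, pull h z ∈ planes := by
  decide +kernel

theorem affs_one : ∀ s ∈ masks 1, ∃ h ∈ affs, pull h s = 1 := by decide +kernel

theorem affs_two : ∀ s ∈ masks 2, ∃ h ∈ affs, pull h s = 3 := by decide +kernel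

theorem affs_three : ∀ s ∈ masks 3, ∃ h ∈ affs, pull h s = 84 := by decide +kernel

theorem stabs_two : ∀ s ∈ masks 2, ∃ h ∈ stabs, pull h s ∈ [3, 5, 6, 10, 20] := by
  decide +kernel

theorem stabs_three : ∀ s ∈ masks 3, s &&& 85 = s → s ≠ 84 → ∃ h ∈ stabs, pull h s = 81 := by
  decide +kernel

theorem exists_plane : ∀ s ∈ masks 3, ∃ z ∈ planes, s &&& z = s := by decide +kernel

theorem planes_eq : ∀ a ∈ planes, ∀ b ∈ planes, pop (a &&& b) = 4 → a = b := by decide +kernel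

theorem eq_of_pair : ∀ p ∈ masks 2, ∀ z < 256, p &&& z = p → pop z ≤ 2 → z = p := by
  decide +kernel

theorem front_four : ∀ a ∈ masks 4, (front a).Perm (List.range 8) ∧ pull (front a) a = 15 := by
  decide +kernel

theorem front_five : ∀ q ∈ masks 5, (front q).Perm (List.range 8) ∧ pull (front q) q = 31 := by
  decide +kernel

theorem frame_spec : ∀ b ∈ masks 4, pop (15 &&& b) = 2 →
    (frame b).Perm (List.range 8) ∧ pull (frame b) 15 = 15 ∧ pull (frame b) b = 51 := by
  decide +kernel

theorem third_eq : ∀ c ∈ masks 4, c &&& 3 = 3 → pop (15 &&& c) ≤ 2 → pop (51 &&& c) ≤ 2 →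
    c = 195 := by decide +kernel

theorem pairs_card : ∀ z ∈ masks 4, ((masks 2).filter fun p => p &&& z = p).length = 6 := by
  decide +kernel

theorem exists_outer_pair : ∀ a ∈ masks 4, pop (31 &&& a) ≤ 2 →
    ∃ p ∈ [96, 160, 192], p &&& a = p := by
  decide +kernel

/-- The quadruples meeting `15`, `51` and `195` in at most two points. -/
def quads : List ℕ := (masks 4).filter fun z =>
  decide (pop (15 &&& z) ≤ 2) && decide (pop (51 &&& z) ≤ 2) && decide (pop (195 &&& z) ≤ 2)

/-- The triples of points of a mask, as a bit set. -/
def triples (z : ℕ) : ℕ :=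
  bits (fun t => z.testBit t.1 && z.testBit t.2.1 && z.testBit t.2.2) (comb3 (List.range 8))

/-- The transposition of the last two points. -/
def swap : List ℕ := [0, 1, 2, 3, 4, 5, 7, 6]

theorem swap_spec : swap.Perm (List.range 8) ∧ pull swap 15 = 15 ∧ pull swap 51 = 51 ∧
    pull swap 195 = 195 ∧ ∀ z ∈ masks 4, pull swap z ∉ planes ∨ z ∈ planes.map (pull swap) := by
  decide +kernel

set_option maxRecDepth 100000 in
theorem search_quads : ∀ b ∈ quads, b ∉ planes → ∀ b' ∈ quads, pull swap b' ∉ planes →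
    (b = b' ∨ pop (b &&& b') ≤ 2) →
    search (cond (Nat.beq b b') 8 7) (cond (Nat.beq b b') 8 7)
      ((quads.filter fun z => decide (pop (b &&& z) ≤ 2) && decide (pop (b' &&& z) ≤ 2)).map
        fun z => (1, triples z)) = true := by
  decide +kernel

set_option maxRecDepth 100000 in
theorem stabs_triple : ∀ v ∈ planes, v ≠ 85 → ∀ b ∈ masks 3, (b &&& 85 = b ∨ b &&& v = b) →
    b ≠ 84 → ∀ c ∈ masks 3, b < c → (c &&& 85 = c ∨ c &&& v = c) → c ≠ 84 →
    ∃ h ∈ stabs, ∃ x ∈ tripleReps, x.1.1 = pull h v ∧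
      ((x.1.2.1 = pull h b ∧ x.1.2.2 = pull h c) ∨ (x.1.2.1 = pull h c ∧ x.1.2.2 = pull h b)) := by
  decide +kernel

/-- The rows of an admissible 16-row matrix with many ones, seen from a row with eight ones:
`m k` is the trace of row `k` on that row, and `R j` is the support of the `j`-th further column. -/
structure RowStar (m : Fin 15 → ℕ) (R : Fin 8 → Finset (Fin 15)) : Prop where
  lt : ∀ k, m k < 256
  pair : ∀ k l, k ≠ l → pop (m k &&& m l) ≤ 2
  triple : ∀ k l n, k ≠ l → k ≠ n → l ≠ n → pop (m k &&& m l &&& m n) +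
    (Finset.univ.filter fun j => k ∈ R j ∧ l ∈ R j ∧ n ∈ R j).card ≤ 2
  choose_le : ∑ k, (pop (m k)).choose 3 ≤ 56
  low : 57 ≤ ∑ k, pop (m k)
  need : 121 ≤ ∑ k, pop (m k) + ∑ j, (R j).card

theorem RowStar.permute {m : Fin 15 → ℕ} {R : Fin 8 → Finset (Fin 15)} (S : RowStar m R) {h : List ℕ}
    (hh : h.Perm (List.range 8)) : RowStar (fun k => pull h (m k)) R where
  lt k := pull_lt hh _
  pair k l hkl := by
    rw [← pull_land, pop_pull hh]
    exact S.pair k l hkl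
  triple k l n h1 h2 h3 := by
    rw [← pull_land, ← pull_land, pop_pull hh]
    exact S.triple k l n h1 h2 h3
  choose_le := by simpa only [pop_pull hh] using S.choose_le
  low := by simpa only [pop_pull hh] using S.low
  need := by simpa only [pop_pull hh] using S.need

theorem RowStar.false_of_check {m : Fin 15 → ℕ} {R : Fin 8 → Finset (Fin 15)} (S : RowStar m R)
    (hinj : ∀ k l, k ≠ l → m k ≠ m l) (c : List ℕ) (hc : c.length = 15) (hm : ∀ k, m k ∈ c)
    (w : ℕ) (h : check c w (121 - (c.map pop).sum) = true) : False := by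
  have hidx : ∀ k, ∃ i : Fin 15, c.getD i 0 = m k := by
    intro k
    obtain ⟨i, hi, e⟩ := List.getElem_of_mem (hm k)
    exact ⟨⟨i, by omega⟩, (List.getD_eq_getElem _ _ _).trans e⟩
  choose f hf using hidx
  have hfi : Function.Injective f := by
    intro k l hkl
    by_contra hne
    exact hinj k l hne (by rw [← hf k, ← hf l, hkl])
  let e : Fin 15 ≃ Fin 15 := Equiv.ofBijective f hfi.bijective_of_finite
  have he : ∀ i : Fin 15, c.getD i 0 = m (e.symm i) := by
    intro i
    have h1 : f (e.symm i) = i := e.apply_symm_apply i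
    rw [← hf (e.symm i), h1]
  have hsum : (c.map pop).sum = ∑ k, pop (m k) := by
    rw [← Equiv.sum_comp e.symm (fun k => pop (m k))]
    simp only [← he]
    rw [← List.sum_ofFn]
    congr 1
    refine List.ext_getElem (by simp [hc]) fun i hi hi' => ?_
    rw [List.getElem_map, List.getElem_ofFn, List.getD_eq_getElem]
  have hcard : ∀ j, ((R j).map e.toEmbedding).card = (R j).card := fun j => Finset.card_map _
  have hmem : ∀ j i, i ∈ (R j).map e.toEmbedding ↔ e.symm i ∈ R j := fun j i =>
    Finset.mem_map_equiv
  have hne : ∀ {a b : Fin 15}, a < b → e.symm a ≠ e.symm b := fun h =>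
    e.symm.injective.ne h.ne
  have hlt : ∀ a b d : Fin 15, m a &&& m b &&& m d < 256 := fun a b d =>
    (Nat.and_le_left.trans Nat.and_le_left).trans_lt (S.lt a)
  have := check_sound c hc w _ h (fun j => (R j).map e.toEmbedding) (by
    intro a b d hab hbd h0 j j' hj h1 h2 h3 h4 h5 h6
    rw [hmem] at h1 h2 h3 h4 h5 h6
    rw [he, he, he] at h0
    have h7 := one_le_pop _ (hlt _ _ _) h0
    have h8 := S.triple _ _ _ (hne hab) (hne (hab.trans hbd)) (hne hbd)
    have h9 : ({j, j'} : Finset (Fin 8)).card ≤ _ := Finset.card_le_card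
      (t := Finset.univ.filter fun j => e.symm a ∈ R j ∧ e.symm b ∈ R j ∧ e.symm d ∈ R j) (by
        intro i hi
        rw [Finset.mem_insert, Finset.mem_singleton] at hi
        rw [Finset.mem_filter]
        rcases hi with rfl | rfl
        · exact ⟨Finset.mem_univ _, h1, h2, h3⟩
        · exact ⟨Finset.mem_univ _, h4, h5, h6⟩)
    rw [Finset.card_pair hj] at h9
    omega) (by
    intro a b d hab hbd h0 j h1 h2 h3
    rw [hmem] at h1 h2 h3
    rw [he, he, he] at h0
    have h7 := two_le_pop _ (hlt _ _ _) h0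
    have h8 := S.triple _ _ _ (hne hab) (hne (hab.trans hbd)) (hne hbd)
    have h9 : ({j} : Finset (Fin 8)).card ≤ _ := Finset.card_le_card
      (t := Finset.univ.filter fun j => e.symm a ∈ R j ∧ e.symm b ∈ R j ∧ e.symm d ∈ R j) (by
        intro i hi
        rw [Finset.mem_singleton] at hi
        subst hi
        rw [Finset.mem_filter]
        exact ⟨Finset.mem_univ _, h1, h2, h3⟩)
    rw [Finset.card_singleton] at h9
    omega)
  simp only [hcard] at this
  have := S.need
  omega

theorem pop_le (z : ℕ) : pop z ≤ 8 := by
  simpa [pop] using List.countP_le_length (l := List.range 8) (p := fun i => z.testBit i)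

theorem slack_choose : ∀ s < 9, 3 * s ≤ s.choose 3 + 8 ∧ (5 ≤ s → 3 * s + 3 ≤ s.choose 3 + 8) ∧
    (6 ≤ s → 3 * s + 10 ≤ s.choose 3 + 8) := by
  decide

theorem pop_planes : ∀ z ∈ planes, pop z = 4 := by decide

theorem three_le_pop : ∀ x ∈ comb3 (List.range 8), ∀ z < 256, z.testBit x.1 = true →
    z.testBit x.2.1 = true → z.testBit x.2.2 = true → 3 ≤ pop z := by
  decide +kernel

theorem land_triples {a b : ℕ} (ha : a < 256) (h : pop (a &&& b) ≤ 2) :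
    Nat.land (triples a) (triples b) = 0 := by
  refine natLand_eq_zero fun t h1 h2 => ?_
  rw [triples, testBit_bits] at h1 h2
  obtain ⟨x, hx, h1⟩ := h1
  obtain ⟨y, hy, h2⟩ := h2
  rw [hx, Option.some.injEq] at hy
  subst hy
  simp only [Bool.and_eq_true] at h1 h2
  have := three_le_pop x (List.mem_of_getElem? hx) (a &&& b) (Nat.and_le_left.trans_lt ha)
    (by rw [Nat.testBit_and, h1.1.1, h2.1.1]; rfl) (by rw [Nat.testBit_and, h1.1.2, h2.1.2]; rfl)
    (by rw [Nat.testBit_and, h1.2, h2.2]; rfl)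
  omega

theorem masks_nodup (n : ℕ) : (masks n).Nodup := List.nodup_range.filter _

/-- The rows that meet the given row in four points. -/
def fours (m : Fin 15 → ℕ) : Finset (Fin 15) := Finset.univ.filter fun k => pop (m k) = 4

theorem mem_fours {m : Fin 15 → ℕ} {k : Fin 15} : k ∈ fours m ↔ pop (m k) = 4 := by
  simp [fours]

namespace RowStar

theorem pop_le_five {m : Fin 15 → ℕ} {R : Fin 8 → Finset (Fin 15)} (S : RowStar m R) (k : Fin 15) :
    pop (m k) ≤ 5 := by
  by_contra! hk
  have h : ∑ i, (3 * pop (m i) + if i = k then 10 else 0) ≤ ∑ i, ((pop (m i)).choose 3 + 8) := by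
    refine Finset.sum_le_sum fun i _ => ?_
    have h1 := slack_choose _ (Nat.lt_succ_of_le (pop_le (m i)))
    split_ifs with hi
    · subst hi
      exact h1.2.2 hk
    · exact h1.1
  rw [Finset.sum_add_distrib, Finset.sum_add_distrib, ← Finset.mul_sum, Finset.sum_ite_eq'] at h
  have h1 := S.choose_le
  have h2 := S.low
  simp at h
  omega

theorem eq_of_five {m : Fin 15 → ℕ} {R : Fin 8 → Finset (Fin 15)} (S : RowStar m R) {k l : Fin 15}
    (hk : pop (m k) = 5) (hl : pop (m l) = 5) : k = l := by
  by_contra hkl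
  have h : ∑ i, (3 * pop (m i) + ((if i = k then 3 else 0) + if i = l then 3 else 0)) ≤
      ∑ i, ((pop (m i)).choose 3 + 8) := by
    refine Finset.sum_le_sum fun i _ => ?_
    have h1 := slack_choose _ (Nat.lt_succ_of_le (pop_le (m i)))
    by_cases hi : i = k
    · rw [if_pos hi, if_neg (hi ▸ hkl)]
      exact h1.2.1 (hi ▸ hk.ge)
    · rw [if_neg hi]
      split_ifs with hj
      · simpa using h1.2.1 (hj ▸ hl.ge)
      · exact h1.1
  rw [Finset.sum_add_distrib, Finset.sum_add_distrib, Finset.sum_add_distrib, ← Finset.mul_sum,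
    Finset.sum_ite_eq', Finset.sum_ite_eq'] at h
  have h1 := S.choose_le
  have h2 := S.low
  simp at h
  omega

/-- Two quadruples sharing a pair can be moved to standard position, and then any further
quadruple through the same pair is determined. -/
theorem exists_frame {m : Fin 15 → ℕ} {R : Fin 8 → Finset (Fin 15)} (S : RowStar m R)
    {k l : Fin 15} (hkl : k ≠ l) (hk : pop (m k) = 4) (hl : pop (m l) = 4) {p : ℕ}
    (hp : p ∈ masks 2) (hpk : p &&& m k = p) (hpl : p &&& m l = p) :
    ∃ m' : Fin 15 → ℕ, RowStar m' R ∧ (∀ i, pop (m' i) = pop (m i)) ∧ m' k = 15 ∧ m' l = 51 ∧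
      ∀ n, n ≠ k → n ≠ l → pop (m n) = 4 → p &&& m n = p → m' n = 195 := by
  have hz : m k &&& m l = p := eq_of_pair p hp _ (Nat.and_le_left.trans_lt (S.lt k))
    (by rw [← Nat.and_assoc, hpk, hpl]) (S.pair k l hkl)
  obtain ⟨f1, f2⟩ := front_four (m k) (mem_masks.2 ⟨S.lt k, hk⟩)
  have S1 := S.permute f1
  set m1 : Fin 15 → ℕ := fun i => pull (front (m k)) (m i) with hm1
  have e1 : m1 k = 15 := f2
  have p1 : ∀ i, pop (m1 i) = pop (m i) := fun i => pop_pull f1 _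
  have z1 : ∀ n, p &&& m n = p → m1 k &&& m1 l &&& m1 n = m1 k &&& m1 l := by
    intro n hn
    simp only [hm1]
    rw [← pull_land, ← pull_land, hz, hn]
  have hb : pop (15 &&& m1 l) = 2 := by
    rw [← e1, ← pull_land, pop_pull f1, hz]
    exact (mem_masks.1 hp).2
  obtain ⟨g1, g2, g3⟩ := frame_spec (m1 l) (mem_masks.2 ⟨S1.lt l, (p1 l).trans hl⟩) hb
  have S2 := S1.permute g1
  have p2 : ∀ i, pop (pull (frame (m1 l)) (m1 i)) = pop (m i) := fun i =>
    (pop_pull g1 _).trans (p1 i)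
  refine ⟨_, S2, p2, by rw [e1, g2], g3, fun n hnk hnl hn hpn => ?_⟩
  have z2 := congrArg (pull (frame (m1 l))) (z1 n hpn)
  rw [pull_land, pull_land, e1, g2, g3] at z2
  have q1 := S2.pair k n (Ne.symm hnk)
  have q2 := S2.pair l n (Ne.symm hnl)
  rw [e1, g2] at q1
  rw [g3] at q2
  exact third_eq _ (mem_masks.2 ⟨S2.lt n, (p2 n).trans hn⟩) (by rw [Nat.and_comm]; exact z2) q1 q2

theorem pop_le_four {m : Fin 15 → ℕ} {R : Fin 8 → Finset (Fin 15)} (S : RowStar m R) (k : Fin 15) :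
    pop (m k) ≤ 4 := by
  by_contra! hk
  have h5 : pop (m k) = 5 := le_antisymm (S.pop_le_five k) hk
  obtain ⟨f1, f2⟩ := front_five (m k) (mem_masks.2 ⟨S.lt k, h5⟩)
  have S1 := S.permute f1
  set m1 : Fin 15 → ℕ := fun i => pull (front (m k)) (m i) with hm1
  have e1 : m1 k = 31 := f2
  have k5 : pop (m1 k) = 5 := (pop_pull f1 _).trans h5
  have hcard : 10 ≤ (fours m1).card := by
    have h : ∑ i, pop (m1 i) ≤ ∑ i, (3 + ((if pop (m1 i) = 4 then 1 else 0) +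
        if i = k then 2 else 0)) := by
      refine Finset.sum_le_sum fun i _ => ?_
      by_cases hi : i = k
      · subst hi
        simp [k5]
      · have h1 := S1.pop_le_five i
        have h2 : pop (m1 i) ≠ 5 := fun h => hi (S1.eq_of_five h k5)
        rw [if_neg hi]
        split_ifs <;> omega
    rw [Finset.sum_add_distrib, Finset.sum_add_distrib, Finset.sum_ite_eq', ← Finset.card_filter] at h
    have h2 := S1.low
    simp at h
    rw [fours]
    omega
  have hex : ∀ i, ∃ p, i ∈ fours m1 → p ∈ [96, 160, 192] ∧ p &&& m1 i = p := by
    intro i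
    by_cases hi : i ∈ fours m1
    · have h4 := mem_fours.1 hi
      have hik : k ≠ i := by
        rintro rfl
        omega
      have h2 := S1.pair k i hik
      rw [e1] at h2
      obtain ⟨p, hp⟩ := exists_outer_pair _ (mem_masks.2 ⟨S1.lt i, h4⟩) h2
      exact ⟨p, fun _ => hp⟩
    · exact ⟨0, fun h => absurd h hi⟩
  choose f hf using hex
  obtain ⟨p, hp, hlt⟩ := Finset.exists_lt_card_fiber_of_mul_lt_card_of_maps_to
    (s := fours m1) (t := {96, 160, 192}) (f := f) (n := 3)
    (fun i hi => by simpa using (hf i hi).1)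
    (by rw [show ({96, 160, 192} : Finset ℕ).card = 3 from rfl]; omega)
  obtain ⟨a, b, c, ha, hb, hc, hab, hac, hbc⟩ := Finset.two_lt_card_iff.1 ((Nat.lt_succ_self 2).trans hlt)
  have hp2 : p ∈ masks 2 := by
    have h : ∀ p ∈ ({96, 160, 192} : Finset ℕ), p ∈ masks 2 := by decide
    exact h p hp
  have key : ∀ i ∈ (fours m1).filter (fun i => f i = p), pop (m1 i) = 4 ∧ p &&& m1 i = p := by
    intro i hi
    rw [Finset.mem_filter] at hi
    exact ⟨mem_fours.1 hi.1, hi.2 ▸ (hf i hi.1).2⟩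
  obtain ⟨m2, S2, q, -, -, h195⟩ := S1.exists_frame hab (key a ha).1 (key b hb).1 hp2 (key a ha).2
    (key b hb).2
  have hd : ∃ d ∈ (fours m1).filter (fun i => f i = p), d ∉ ({a, b, c} : Finset (Fin 15)) := by
    by_contra! hall
    have h1 := Finset.card_le_card (show (fours m1).filter (fun i => f i = p) ⊆ {a, b, c} from hall)
    have h2 := Finset.card_le_three (a := a) (b := b) (c := c)
    omega
  obtain ⟨d, hd, hd'⟩ := hd
  simp only [Finset.mem_insert, Finset.mem_singleton, not_or] at hd'
  have h1 := h195 c hac.symm hbc.symm (key c hc).1 (key c hc).2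
  have h2 := h195 d hd'.1 hd'.2.1 (key d hd).1 (key d hd).2
  have h3 := S2.pair c d (Ne.symm hd'.2.2)
  rw [h1, h2] at h3
  exact absurd h3 (by decide)

theorem injective {m : Fin 15 → ℕ} {R : Fin 8 → Finset (Fin 15)} (S : RowStar m R) (k l : Fin 15)
    (hkl : k ≠ l) : m k ≠ m l := by
  intro he
  have hk := S.pair k l hkl
  have hl := hk
  rw [← he, Nat.and_self] at hk
  rw [he, Nat.and_self] at hl
  have h : ∑ i, (pop (m i) + ((if i = k then 2 else 0) + if i = l then 2 else 0)) ≤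
      ∑ _i : Fin 15, 4 := by
    refine Finset.sum_le_sum fun i _ => ?_
    have h1 := S.pop_le_four i
    by_cases hi : i = k
    · subst hi
      rw [if_pos rfl, if_neg hkl]
      omega
    · rw [if_neg hi]
      split_ifs with hj
      · subst hj
        omega
      · omega
  rw [Finset.sum_add_distrib, Finset.sum_add_distrib, Finset.sum_ite_eq', Finset.sum_ite_eq'] at h
  have h2 := S.low
  simp at h
  omega

theorem le_card_fours {m : Fin 15 → ℕ} {R : Fin 8 → Finset (Fin 15)} (S : RowStar m R) :
    12 ≤ (fours m).card := by
  have h : ∑ i, pop (m i) ≤ ∑ i, (3 + if pop (m i) = 4 then 1 else 0) := by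
    refine Finset.sum_le_sum fun i _ => ?_
    have h1 := S.pop_le_four i
    split_ifs <;> omega
  rw [Finset.sum_add_distrib, ← Finset.card_filter] at h
  have h2 := S.low
  simp at h
  rw [fours]
  omega

theorem exists_popular_pair {m : Fin 15 → ℕ} {R : Fin 8 → Finset (Fin 15)} (S : RowStar m R) :
    ∃ p ∈ masks 2, 2 < ((fours m).filter fun k => p &&& m k = p).card := by
  by_contra! hall
  have h := Finset.sum_card_bipartiteAbove_eq_sum_card_bipartiteBelow (s := (masks 2).toFinset)
    (t := fours m) fun p k => p &&& m k = p
  have h1 : ∑ p ∈ (masks 2).toFinset, ((fours m).bipartiteAbove (fun p k => p &&& m k = p) p).card ≤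
      ∑ _p ∈ (masks 2).toFinset, 2 :=
    Finset.sum_le_sum fun p hp => hall p (List.mem_toFinset.1 hp)
  have h2 : ∑ k ∈ fours m, ((masks 2).toFinset.bipartiteBelow (fun p k => p &&& m k = p) k).card =
      ∑ _k ∈ fours m, 6 := by
    refine Finset.sum_congr rfl fun k hk => ?_
    refine Eq.trans (congrArg Finset.card (Finset.ext fun p => ?_))
      ((List.toFinset_card_of_nodup ((masks_nodup 2).filter _)).trans
        (pairs_card (m k) (mem_masks.2 ⟨S.lt k, mem_fours.1 hk⟩)))
    rw [Finset.mem_bipartiteBelow, List.mem_toFinset, List.mem_toFinset, List.mem_filter,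
      decide_eq_true_eq]
  have h3 : (masks 2).toFinset.card = 28 := by
    rw [List.toFinset_card_of_nodup (masks_nodup 2)]
    decide +kernel
  rw [h2] at h
  simp only [Finset.sum_const, smul_eq_mul, h3] at h h1
  have := S.le_card_fours
  omega
end RowStar

theorem mem_quads {z : ℕ} : z ∈ quads ↔
    z ∈ masks 4 ∧ (pop (15 &&& z) ≤ 2 ∧ pop (51 &&& z) ≤ 2) ∧ pop (195 &&& z) ≤ 2 := by
  simp only [quads, List.mem_filter, Bool.and_eq_true, decide_eq_true_eq]

theorem RowStar.false_of_nonplanes {m : Fin 15 → ℕ} {R : Fin 8 → Finset (Fin 15)} (S : RowStar m R)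
    {a b c : Fin 15} (hab : a ≠ b) (hac : a ≠ c) (hbc : b ≠ c) (ea : m a = 15) (eb : m b = 51)
    (ec : m c = 195) {k l : Fin 15} (hk : pop (m k) = 4) (hl : pop (m l) = 4)
    (hkp : m k ∉ planes) (hlp : pull swap (m l) ∉ planes) : False := by
  have hq : ∀ i, pop (m i) = 4 → i ≠ a → i ≠ b → i ≠ c → m i ∈ quads := fun i hi ia ib ic =>
    mem_quads.2 ⟨mem_masks.2 ⟨S.lt i, hi⟩, ⟨ea ▸ S.pair a i ia.symm, eb ▸ S.pair b i ib.symm⟩,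
      ec ▸ S.pair c i ic.symm⟩
  obtain ⟨-, s1, s2, s3, -⟩ := swap_spec
  have hkq : m k ∈ quads := hq k hk (by rintro rfl; exact hkp (ea ▸ by decide))
    (by rintro rfl; exact hkp (eb ▸ by decide)) (by rintro rfl; exact hkp (ec ▸ by decide))
  have hlq : m l ∈ quads := hq l hl (by rintro rfl; exact hlp (ea ▸ s1 ▸ by decide))
    (by rintro rfl; exact hlp (eb ▸ s2 ▸ by decide)) (by rintro rfl; exact hlp (ec ▸ s3 ▸ by decide))
  have hor : m k = m l ∨ pop (m k &&& m l) ≤ 2 := by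
    by_cases h : k = l
    · exact Or.inl (by rw [h])
    · exact Or.inr (S.pair k l h)
  have hs := search_quads _ hkq hkp _ hlq hlp hor
  have hn : cond (Nat.beq (m k) (m l)) 8 7 ≤ (fours m \ ({a, b, c} ∪ {k, l})).card := by
    have h1 := S.le_card_fours
    have h2 := Finset.le_card_sdiff (({a, b, c} : Finset (Fin 15)) ∪ {k, l}) (fours m)
    have h3 := Finset.card_union_le ({a, b, c} : Finset (Fin 15)) {k, l}
    have h4 := Finset.card_le_three (a := a) (b := b) (c := c)
    by_cases h : k = l
    · subst h
      rw [show ({k, k} : Finset (Fin 15)).card = 1 by simp] at h3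
      cases Nat.beq (m k) (m k) <;> simp only [cond_true, cond_false] <;> omega
    · have h5 : Nat.beq (m k) (m l) = false := by
        rw [Bool.eq_false_iff, Ne, Nat.beq_eq]
        exact S.injective k l h
      have h6 := Finset.card_le_two (a := k) (b := l)
      rw [h5, cond_false]
      omega
  obtain ⟨U, hU, hcard⟩ := Finset.exists_subset_card_eq hn
  have hU' : ∀ i ∈ U, pop (m i) = 4 ∧ i ≠ a ∧ i ≠ b ∧ i ≠ c ∧ i ≠ k ∧ i ≠ l := by
    intro i hi
    have := hU hi
    simp only [Finset.mem_sdiff, Finset.mem_union, Finset.mem_insert, Finset.mem_singleton,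
      not_or, mem_fours] at this
    obtain ⟨h1, ⟨h2, h3, h4⟩, h5, h6⟩ := this
    exact ⟨h1, h2, h3, h4, h5, h6⟩
  have h := search_sound _ _ _ (List.pairwise_of_forall_mem_list (by
      intro x hx y hy
      obtain ⟨_, -, rfl⟩ := List.mem_map.1 hx
      obtain ⟨_, -, rfl⟩ := List.mem_map.1 hy
      exact le_rfl)) hs (U.toList.map fun i => (1, triples (m i))) (by simpa using hcard) (by
      intro x hx
      obtain ⟨i, hi, rfl⟩ := List.mem_map.1 hx
      obtain ⟨h4, ia, ib, ic, ik, il⟩ := hU' i (Finset.mem_toList.1 hi)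
      refine List.mem_map.2 ⟨m i, List.mem_filter.2 ⟨hq i h4 ia ib ic, ?_⟩, rfl⟩
      rw [Bool.and_eq_true, decide_eq_true_eq, decide_eq_true_eq]
      exact ⟨S.pair k i ik.symm, S.pair l i il.symm⟩) (by
      rw [List.pairwise_map]
      exact U.nodup_toList.imp fun {i j} hij => land_triples (S.lt i) (S.pair i j hij))
  rw [List.map_map, show (Prod.fst ∘ fun i => (1, triples (m i))) = fun _ : Fin 15 => 1 from rfl] at h
  simp only [List.map_const', List.sum_replicate, Finset.length_toList, hcard, smul_eq_mul,
    mul_one, lt_irrefl] at h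

theorem RowStar.exists_planes {m : Fin 15 → ℕ} {R : Fin 8 → Finset (Fin 15)} (S : RowStar m R) :
    ∃ m' : Fin 15 → ℕ, RowStar m' R ∧ ∀ k, pop (m' k) = 4 → m' k ∈ planes := by
  obtain ⟨p, hp, hlt⟩ := S.exists_popular_pair
  obtain ⟨a, b, c, ha, hb, hc, hab, hac, hbc⟩ := Finset.two_lt_card_iff.1 hlt
  rw [Finset.mem_filter, mem_fours] at ha hb hc
  obtain ⟨m', S', q, ea, eb, h195⟩ := S.exists_frame hab ha.1 hb.1 hp ha.2 hb.2
  have ec := h195 c hac.symm hbc.symm hc.1 hc.2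
  by_cases hA : ∀ k, pop (m' k) = 4 → m' k ∈ planes
  · exact ⟨m', S', hA⟩
  by_cases hB : ∀ k, pop (m' k) = 4 → pull swap (m' k) ∈ planes
  · exact ⟨_, S'.permute swap_spec.1, fun k hk => hB k (by rwa [pop_pull swap_spec.1] at hk)⟩
  push Not at hA hB
  obtain ⟨k, hk, hkp⟩ := hA
  obtain ⟨l, hl, hlp⟩ := hB
  exact (S'.false_of_nonplanes hab hac hbc ea eb ec hk hl hkp hlp).elim

theorem RowStar.card_absent {m : Fin 15 → ℕ} {R : Fin 8 → Finset (Fin 15)} (S : RowStar m R)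
    (hm : ∀ k, pop (m k) = 4 → m k ∈ planes) (A : Finset ℕ) (hA : ∀ z ∈ A, z ∈ planes)
    (hA' : ∀ z ∈ A, ∀ k, m k ≠ z) : (fours m).card + A.card ≤ 14 := by
  rw [← Finset.card_image_of_injOn (f := m) (s := fours m)
    (fun k _ l _ h => by_contra fun hkl => S.injective k l hkl h), ← Finset.card_union_of_disjoint]
  · refine (Finset.card_le_card (t := planes.toFinset) ?_).trans (by decide)
    intro z hz
    rw [List.mem_toFinset]
    rcases Finset.mem_union.1 hz with hz | hz
    · obtain ⟨k, hk, rfl⟩ := Finset.mem_image.1 hz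
      exact hm k (mem_fours.1 hk)
    · exact hA z hz
  · rw [Finset.disjoint_left]
    rintro z hz hz'
    obtain ⟨k, -, rfl⟩ := Finset.mem_image.1 hz
    exact hA' _ hz' k rfl

theorem RowStar.plane_ne {m : Fin 15 → ℕ} {R : Fin 8 → Finset (Fin 15)} (S : RowStar m R)
    {k : Fin 15} (hk : pop (m k) = 3) {z : ℕ} (hz : z ∈ planes) (h : m k &&& z = m k) (l : Fin 15) :
    m l ≠ z := by
  rintro rfl
  have hkl : k ≠ l := by
    rintro rfl
    have := pop_planes _ hz
    omega
  have := S.pair k l hkl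
  rw [h] at this
  omega

theorem RowStar.false_of_one {m : Fin 15 → ℕ} {R : Fin 8 → Finset (Fin 15)} (S : RowStar m R)
    (hm : ∀ k, pop (m k) = 4 → m k ∈ planes) {a : Fin 15} (ha : pop (m a) = 1 ∨ pop (m a) = 2)
    (h : ∀ k, k ≠ a → pop (m k) = 4) : False := by
  rcases ha with ha | ha
  · obtain ⟨f, hf, e⟩ := affs_one _ (mem_masks.2 ⟨S.lt a, ha⟩)
    obtain ⟨f1, f2⟩ := perm_affs f hf
    refine (S.permute f1).false_of_check (S.permute f1).injective (planes ++ [1]) rfl (fun k => ?_) 7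
      check_one
    by_cases hk : k = a
    · subst hk
      simp [e]
    · exact List.mem_append_left _ (f2 _ (hm k (h k hk)))
  · obtain ⟨f, hf, e⟩ := affs_two _ (mem_masks.2 ⟨S.lt a, ha⟩)
    obtain ⟨f1, f2⟩ := perm_affs f hf
    refine (S.permute f1).false_of_check (S.permute f1).injective (planes ++ [3]) rfl (fun k => ?_) 6
      check_two
    by_cases hk : k = a
    · subst hk
      simp [e]
    · exact List.mem_append_left _ (f2 _ (hm k (h k hk)))

/-- A triple can be moved to the standard triple `84`. -/
theorem RowStar.exists_triple {m : Fin 15 → ℕ} {R : Fin 8 → Finset (Fin 15)} (S : RowStar m R)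
    (hm : ∀ k, pop (m k) = 4 → m k ∈ planes) {a : Fin 15} (ha : pop (m a) = 3) :
    ∃ m' : Fin 15 → ℕ, RowStar m' R ∧ (∀ k, pop (m' k) = 4 → m' k ∈ planes) ∧
      (∀ k, pop (m' k) = pop (m k)) ∧ m' a = 84 := by
  obtain ⟨f, hf, e⟩ := affs_three _ (mem_masks.2 ⟨S.lt a, ha⟩)
  obtain ⟨f1, f2⟩ := perm_affs f hf
  exact ⟨_, S.permute f1, fun k hk => f2 _ (hm k (by rwa [pop_pull f1] at hk)),
    fun k => pop_pull f1 _, e⟩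

theorem RowStar.false_of_pair {m : Fin 15 → ℕ} {R : Fin 8 → Finset (Fin 15)} (S : RowStar m R)
    {a b : Fin 15} (ea : m a = 84) {f : List ℕ} (hf : f ∈ stabs)
    (hm : ∀ k, k ≠ a → k ≠ b → m k ∈ planes) {s : ℕ} (e : pull f (m b) = s)
    (hs : s ∈ [3, 5, 6, 10, 20, 81]) : False := by
  obtain ⟨f1, f2, f3⟩ := perm_stabs f hf
  have S' := S.permute f1
  refine S'.false_of_check S'.injective (planes.erase 85 ++ [84, s]) rfl (fun k => ?_) 7
    (check_pair s hs)
  by_cases hka : k = a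
  · subst hka
    simp [ea, f2]
  by_cases hkb : k = b
  · subst hkb
    simp [e]
  have h85 := S'.plane_ne (k := a) (by rw [ea, f2]; decide) (z := 85) (by decide)
    (by rw [ea, f2]; decide) k
  exact List.mem_append_left _ ((List.mem_erase_of_ne h85).2 (f3 _ (hm k hka hkb)))

theorem RowStar.false_of_two {m : Fin 15 → ℕ} {R : Fin 8 → Finset (Fin 15)} (S : RowStar m R)
    (hm : ∀ k, pop (m k) = 4 → m k ∈ planes) {a b : Fin 15} (hab : a ≠ b) (ha : pop (m a) = 3)
    (hb : pop (m b) = 2 ∨ pop (m b) = 3) (h : ∀ k, k ≠ a → k ≠ b → pop (m k) = 4)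
    (hc : (fours m).card = 13) : False := by
  obtain ⟨m', S', hm', q, ea⟩ := S.exists_triple hm ha
  have hp : ∀ k, k ≠ a → k ≠ b → m' k ∈ planes := fun k hka hkb =>
    hm' k ((q k).trans (h k hka hkb))
  have hc' : (fours m').card = 13 := by
    simpa only [fours, q] using hc
  rcases hb with hb | hb
  · obtain ⟨f, hf, hs⟩ := stabs_two _ (mem_masks.2 ⟨S'.lt b, (q b).trans hb⟩)
    refine S'.false_of_pair ea hf hp rfl ?_
    revert hs
    generalize pull f (m' b) = s
    simp only [List.mem_cons]
    tauto
  · have hb' := mem_masks.2 ⟨S'.lt b, (q b).trans hb⟩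
    obtain ⟨z, hz, hbz⟩ := exists_plane _ hb'
    have z85 : z = 85 := by
      by_contra hne
      have := S'.card_absent hm' {z, 85} (by simp [hz]; decide) (by
        intro y hy
        rcases Finset.mem_insert.1 hy with rfl | hy
        · exact S'.plane_ne ((q b).trans hb) hz hbz
        · rw [Finset.mem_singleton.1 hy]
          exact S'.plane_ne (k := a) (by rw [ea]; decide) (by decide) (by rw [ea]; decide))
      rw [Finset.card_pair hne] at this
      omega
    subst z85
    obtain ⟨f, hf, hs⟩ := stabs_three _ hb' hbz (by rw [← ea]; exact S'.injective b a hab.symm)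
    exact S'.false_of_pair ea hf hp hs (by decide)

theorem RowStar.false_of_three {m : Fin 15 → ℕ} {R : Fin 8 → Finset (Fin 15)} (S : RowStar m R)
    (hm : ∀ k, pop (m k) = 4 → m k ∈ planes) {a b c : Fin 15} (hab : a ≠ b) (hac : a ≠ c)
    (hbc : b ≠ c) (ha : pop (m a) = 3) (hb : pop (m b) = 3) (hc : pop (m c) = 3)
    (h : ∀ k, k ≠ a → k ≠ b → k ≠ c → pop (m k) = 4) (h12 : (fours m).card = 12) : False := by
  obtain ⟨m, S', hm', q, ea⟩ := S.exists_triple hm ha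
  rename_i m₀
  rw [← q] at ha hb hc
  replace h : ∀ k, k ≠ a → k ≠ b → k ≠ c → m k ∈ planes := fun k h1 h2 h3 =>
    hm' k ((q k).trans (h k h1 h2 h3))
  replace h12 : (fours m).card = 12 := by
    simpa only [fours, q] using h12
  have h85 : ∀ k, m k ≠ 85 := S'.plane_ne ha (by decide) (by rw [ea]; decide)
  obtain ⟨v, hv, hv'⟩ : ∃ v ∈ planes.toFinset.erase 85, v ∉ (fours m).image m := by
    by_contra! hall
    have h1 := Finset.card_le_card (show planes.toFinset.erase 85 ⊆ (fours m).image m from hall)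
    have h2 := Finset.card_image_le (f := m) (s := fours m)
    have h3 : (planes.toFinset.erase 85).card = 13 := by decide
    omega
  rw [Finset.mem_erase, List.mem_toFinset] at hv
  have hvk : ∀ k, m k ≠ v := fun k hk => hv' (Finset.mem_image.2 ⟨k, mem_fours.2
    (hk ▸ pop_planes v hv.2), hk⟩)
  have hsub : ∀ k, pop (m k) = 3 → m k &&& 85 = m k ∨ m k &&& v = m k := by
    intro k hk
    obtain ⟨z, hz, hkz⟩ := exists_plane _ (mem_masks.2 ⟨S'.lt k, hk⟩)
    by_cases z85 : z = 85
    · exact Or.inl (z85 ▸ hkz)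
    by_cases zv : z = v
    · exact Or.inr (zv ▸ hkz)
    have := S'.card_absent hm' {z, v, 85} (by simp [hz, hv.2]; decide) (by
      intro y hy
      simp only [Finset.mem_insert, Finset.mem_singleton] at hy
      rcases hy with rfl | rfl | rfl
      · exact S'.plane_ne hk hz hkz
      · exact hvk
      · exact h85)
    rw [Finset.card_eq_three.2 ⟨z, v, 85, zv, z85, hv.1, rfl⟩] at this
    omega
  have b84 : m b ≠ 84 := ea ▸ S'.injective b a hab.symm
  have c84 : m c ≠ 84 := ea ▸ S'.injective c a hac.symm
  have hb' := mem_masks.2 ⟨S'.lt b, hb⟩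
  have hc' := mem_masks.2 ⟨S'.lt c, hc⟩
  obtain ⟨f, hf, x, hx, hxv, hxb⟩ : ∃ f ∈ stabs, ∃ x ∈ tripleReps, x.1.1 = pull f v ∧
      ((x.1.2.1 = pull f (m b) ∧ x.1.2.2 = pull f (m c)) ∨
        (x.1.2.1 = pull f (m c) ∧ x.1.2.2 = pull f (m b))) := by
    rcases lt_or_gt_of_ne (S'.injective b c hbc) with hlt | hlt
    · exact stabs_triple v hv.2 hv.1 _ hb' (hsub b hb) b84 _ hc' hlt (hsub c hc) c84
    · obtain ⟨f, hf, x, hx, h1, h2⟩ :=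
        stabs_triple v hv.2 hv.1 _ hc' (hsub c hc) c84 _ hb' hlt (hsub b hb) b84
      exact ⟨f, hf, x, hx, h1, h2.symm⟩
  obtain ⟨f1, f2, f3⟩ := perm_stabs f hf
  have S1 := S'.permute f1
  have hmem : x.1.1 ∈ planes.erase 85 := by
    have hr : ∀ x ∈ tripleReps, x.1.1 ∈ planes.erase 85 := by decide
    exact hr x hx
  refine S1.false_of_check S1.injective _ ?_ (fun k => ?_) x.2 (check_triple x hx)
  · rw [List.length_append, List.length_erase_of_mem hmem]
    rfl
  by_cases hka : k = a
  · subst hka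
    simp [ea, f2]
  by_cases hkb : k = b
  · subst hkb
    rcases hxb with ⟨h1, -⟩ | ⟨-, h1⟩ <;> simp [h1]
  by_cases hkc : k = c
  · subst hkc
    rcases hxb with ⟨-, h1⟩ | ⟨h1, -⟩ <;> simp [h1]
  have hk := h k hka hkb hkc
  have k85 := S1.plane_ne (k := a) (by rw [ea, f2]; decide) (z := 85) (by decide)
    (by rw [ea, f2]; decide) k
  have kv : pull f (m k) ≠ x.1.1 := by
    rw [hxv]
    intro he
    refine hvk k (planes_eq _ hk _ hv.2 ?_)
    rw [← pop_pull f1, pull_land, he, Nat.and_self, pop_pull f1]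
    exact pop_planes v hv.2
  exact List.mem_append_left _ ((List.mem_erase_of_ne kv).2
    ((List.mem_erase_of_ne k85).2 (f3 _ hk)))

theorem RowStar.elim {m : Fin 15 → ℕ} {R : Fin 8 → Finset (Fin 15)} (S : RowStar m R) : False := by
  obtain ⟨m, S, hm⟩ := S.exists_planes
  have h4 := S.pop_le_four
  have hF := S.le_card_fours
  set D : Finset (Fin 15) := Finset.univ.filter fun k => ¬ pop (m k) = 4 with hD
  have hcard : (fours m).card + D.card = 15 := by
    rw [fours, hD, Finset.card_filter_add_card_filter_not]
    rfl
  have hsum : ∀ g : ℕ → ℕ, ∑ k, g (pop (m k)) = (fours m).card * g 4 + ∑ k ∈ D, g (pop (m k)) := by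
    intro g
    rw [← Finset.sum_filter_add_sum_filter_not Finset.univ fun k => pop (m k) = 4]
    congr 1
    rw [Finset.sum_congr rfl (g := fun _ => g 4) fun k hk => by rw [(Finset.mem_filter.1 hk).2],
      Finset.sum_const, smul_eq_mul]
    rfl
  have h1 := S.low
  have h2 := S.choose_le
  rw [show ∑ k, pop (m k) = _ from hsum fun s => s] at h1
  rw [hsum fun s => s.choose 3] at h2
  have hmem : ∀ k, k ∉ D → pop (m k) = 4 := fun k hk => by simpa [hD] using hk
  have hmem' : ∀ k ∈ D, pop (m k) ≤ 3 := fun k hk => by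
    have := h4 k
    have : pop (m k) ≠ 4 := by simpa [hD] using hk
    omega
  rw [show (4 : ℕ).choose 3 = 4 from rfl] at h2
  have hD3 : D.card = 0 ∨ D.card = 1 ∨ D.card = 2 ∨ D.card = 3 := by omega
  rcases hD3 with h0 | h0 | h0 | h0
  · omega
  · obtain ⟨a, ha⟩ := Finset.card_eq_one.1 h0
    rw [ha] at h1 h2 hmem hmem'
    rw [Finset.sum_singleton] at h1 h2
    have ha3 := hmem' a (by simp)
    refine S.false_of_one hm (a := a) ?_ fun k hk => hmem k (by simpa using hk)
    have : pop (m a) ≠ 3 := by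
      intro h
      rw [h] at h2
      simp at h2
      omega
    omega
  · obtain ⟨a, b, hab, ha⟩ := Finset.card_eq_two.1 h0
    rw [ha] at h1 hmem hmem'
    rw [Finset.sum_pair hab] at h1
    have ha3 := hmem' a (by simp)
    have hb3 := hmem' b (by simp)
    have hc : (fours m).card = 13 := by omega
    by_cases h3 : pop (m a) = 3
    · exact S.false_of_two hm hab h3 (by omega) (fun k h1 h2 => hmem k (by simp [h1, h2])) hc
    · exact S.false_of_two hm hab.symm (by omega) (by omega)
        (fun k h1 h2 => hmem k (by simp [h1, h2])) hc
  · obtain ⟨a, b, c, hab, hac, hbc, ha⟩ := Finset.card_eq_three.1 h0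
    rw [ha] at h1 hmem hmem'
    rw [Finset.sum_insert (by simp [hab, hac]), Finset.sum_pair hbc] at h1
    have ha3 := hmem' a (by simp)
    have hb3 := hmem' b (by simp)
    have hc3 := hmem' c (by simp)
    exact S.false_of_three hm hab hac hbc (by omega) (by omega) (by omega)
      (fun k h1 h2 h3 => hmem k (by simp [h1, h2, h3])) (by omega)

/-- The support of a row. -/
def support (M : Fin 16 → Fin 16 → Bool) (i : Fin 16) : Finset (Fin 16) :=
  Finset.univ.filter fun j => M i j = true

theorem mem_support {M : Fin 16 → Fin 16 → Bool} {i j : Fin 16} : j ∈ support M i ↔ M i j = true := by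
  simp [support]

theorem card_support_inter_le {M : Fin 16 → Fin 16 → Bool} (hM : Admissible 3 3 M) {i k l : Fin 16}
    (hik : i ≠ k) (hil : i ≠ l) (hkl : k ≠ l) :
    (support M i ∩ support M k ∩ support M l).card ≤ 2 := by
  by_contra! h
  obtain ⟨C, hC, hcard⟩ := Finset.exists_subset_card_eq (Nat.succ_le_of_lt h)
  refine hM ⟨{i, k, l}, C, Finset.card_eq_three.2 ⟨i, k, l, hik, hil, hkl, rfl⟩, hcard, ?_⟩
  intro a ha j hj
  have := hC hj
  simp only [Finset.mem_inter, mem_support] at this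
  simp only [Finset.mem_insert, Finset.mem_singleton] at ha
  rcases ha with rfl | rfl | rfl
  · exact this.1.1
  · exact this.1.2
  · exact this.2

theorem sum_choose_le {ι α : Type*} [DecidableEq α] (s : Finset ι) (X : Finset α)
    (B : ι → Finset α) (hB : ∀ k ∈ s, B k ⊆ X)
    (h : ∀ k ∈ s, ∀ l ∈ s, k ≠ l → (B k ∩ B l).card ≤ 2) :
    ∑ k ∈ s, (B k).card.choose 3 ≤ X.card.choose 3 := by
  classical
  rw [← Finset.card_powersetCard, Finset.sum_congr rfl fun k _ =>
    (Finset.card_powersetCard 3 (B k)).symm, ← Finset.card_biUnion]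
  · refine Finset.card_le_card (Finset.biUnion_subset.2 fun k hk => ?_)
    exact Finset.powersetCard_mono (hB k hk)
  · intro k hk l hl hkl
    rw [Function.onFun, Finset.disjoint_left]
    intro t ht ht'
    rw [Finset.mem_powersetCard] at ht ht'
    have := Finset.card_le_card (Finset.subset_inter ht.1 ht'.1)
    have := h k hk l hl hkl
    omega

/-- Counting the pairs of intersecting blocks point by point. -/
theorem sum_sq_degree {ι α : Type*} [DecidableEq α] (s : Finset ι) (X : Finset α)
    (B : ι → Finset α) (hB : ∀ k ∈ s, B k ⊆ X) :
    ∑ x ∈ X, (s.filter fun k => x ∈ B k).card ^ 2 = ∑ k ∈ s, ∑ l ∈ s, (B k ∩ B l).card := by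
  have h1 : ∀ x ∈ X, (s.filter fun k => x ∈ B k).card ^ 2 =
      ∑ k ∈ s, ∑ l ∈ s, if x ∈ B k ∩ B l then 1 else 0 := by
    intro x _
    rw [sq, Finset.card_filter, Finset.sum_mul_sum]
    refine Finset.sum_congr rfl fun k _ => Finset.sum_congr rfl fun l _ => ?_
    simp only [Finset.mem_inter]
    by_cases h1 : x ∈ B k <;> by_cases h2 : x ∈ B l <;> simp [h1, h2]
  rw [Finset.sum_congr rfl h1, Finset.sum_comm]
  refine Finset.sum_congr rfl fun k hk => ?_
  rw [Finset.sum_comm]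
  refine Finset.sum_congr rfl fun l _ => ?_
  rw [← Finset.card_filter, Finset.filter_mem_eq_inter,
    Finset.inter_eq_right.2 (Finset.inter_subset_left.trans (hB k hk))]

theorem sum_degree {ι α : Type*} [DecidableEq α] (s : Finset ι) (X : Finset α)
    (B : ι → Finset α) (hB : ∀ k ∈ s, B k ⊆ X) :
    ∑ x ∈ X, (s.filter fun k => x ∈ B k).card = ∑ k ∈ s, (B k).card := by
  simp only [Finset.card_filter]
  rw [Finset.sum_comm]
  refine Finset.sum_congr rfl fun k hk => ?_
  rw [← Finset.card_filter, Finset.filter_mem_eq_inter, Finset.inter_eq_right.2 (hB k hk)]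

/-- No four quintuples among nine points meet pairwise in at most two points. -/
theorem not_four_quintuples {ι α : Type*} [DecidableEq α] (s : Finset ι) (X : Finset α)
    (B : ι → Finset α) (hB : ∀ k ∈ s, B k ⊆ X) (hs : s.card = 4) (hX : X.card = 9)
    (h5 : ∀ k ∈ s, (B k).card = 5)
    (h : ∀ k ∈ s, ∀ l ∈ s, k ≠ l → (B k ∩ B l).card ≤ 2) : False := by
  classical
  have h1 := sum_sq_degree s X B hB
  have h2 := sum_degree s X B hB
  have h3 : ∑ x ∈ X, 5 * (s.filter fun k => x ∈ B k).card ≤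
      ∑ x ∈ X, ((s.filter fun k => x ∈ B k).card ^ 2 + 6) := by
    refine Finset.sum_le_sum fun x _ => ?_
    generalize (s.filter fun k => x ∈ B k).card = d
    rcases Nat.lt_or_ge d 3 with hd | hd
    · interval_cases d <;> norm_num
    · nlinarith
  have h4 : ∑ k ∈ s, ∑ l ∈ s, (B k ∩ B l).card ≤ ∑ k ∈ s, 11 := by
    refine Finset.sum_le_sum fun k hk => ?_
    rw [← Finset.add_sum_erase s _ hk, Finset.inter_self, h5 k hk]
    have : ∑ l ∈ s.erase k, (B k ∩ B l).card ≤ ∑ l ∈ s.erase k, 2 :=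
      Finset.sum_le_sum fun l hl => h k hk l (Finset.mem_of_mem_erase hl)
        (Finset.ne_of_mem_erase hl).symm
    rw [Finset.sum_const, Finset.card_erase_of_mem hk, hs] at this
    simp at this
    omega
  rw [Finset.sum_congr rfl h5] at h2
  rw [← Finset.mul_sum, Finset.sum_add_distrib, h1, h2] at h3
  simp only [Finset.sum_const, hs, hX, smul_eq_mul] at h3 h4
  omega

theorem onesCount_eq_sum (M : Fin 16 → Fin 16 → Bool) :
    onesCount M = ∑ i, (support M i).card := by
  rw [onesCount, Finset.card_filter, Fintype.sum_prod_type]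
  refine Finset.sum_congr rfl fun i _ => ?_
  rw [support, Finset.card_filter]

theorem pop_bits (P : Fin 8 → Bool) :
    pop (bits P (List.finRange 8)) = (Finset.univ.filter fun j => P j = true).card := by
  have h1 : (Finset.univ.filter fun j => P j = true).card = (List.finRange 8).countP P := by
    rw [List.countP_eq_length_filter]
    simp [Finset.card, Finset.univ, Fintype.elems]
  rw [h1, pop, ← List.map_coe_finRange_eq_range, List.countP_map]
  refine List.countP_congr fun j _ => ?_
  rw [Function.comp_apply, testBit_bits]
  simp

theorem bits_land {τ : Type} (P Q : τ → Bool) (l : List τ) :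
    bits P l &&& bits Q l = bits (fun x => P x && Q x) l := by
  refine Nat.eq_of_testBit_eq fun t => ?_
  rw [Bool.eq_iff_iff, Nat.testBit_and, Bool.and_eq_true, testBit_bits, testBit_bits, testBit_bits]
  constructor
  · rintro ⟨⟨x, hx, h1⟩, ⟨y, hy, h2⟩⟩
    rw [hx, Option.some.injEq] at hy
    subst hy
    exact ⟨x, hx, by rw [h1, h2]; rfl⟩
  · rintro ⟨x, hx, h⟩
    rw [Bool.and_eq_true] at h
    exact ⟨⟨x, hx, h.1⟩, ⟨x, hx, h.2⟩⟩

theorem card_filter_orderEmbOfFin (X : Finset (Fin 16)) (h : X.card = 8) (p : Fin 16 → Prop)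
    [DecidablePred p] :
    (Finset.univ.filter fun j => p (X.orderEmbOfFin h j)).card = (X.filter p).card := by
  conv_rhs => rw [← Finset.map_orderEmbOfFin_univ X h, Finset.filter_map, Finset.card_map]
  rfl

theorem sum_erase_eq_succAbove (i : Fin 16) (g : Fin 16 → ℕ) :
    ∑ k ∈ Finset.univ.erase i, g k = ∑ k : Fin 15, g (i.succAbove k) := by
  have h1 := Finset.add_sum_erase Finset.univ g (Finset.mem_univ i)
  rw [Fin.sum_univ_succAbove g i] at h1
  omega

theorem rowStar_of_admissible {M : Fin 16 → Fin 16 → Bool} (hM : Admissible 3 3 M)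
    (hN : 129 ≤ onesCount M) (i : Fin 16) (hi : (support M i).card = 8)
    (hT : 57 ≤ ∑ k ∈ Finset.univ.erase i, (support M i ∩ support M k).card) :
    ∃ m R, RowStar m R := by
  have hi' : (support M i)ᶜ.card = 8 := by
    rw [Finset.card_compl, hi]
    rfl
  set m : Fin 15 → ℕ := fun k => bits (fun j => M (i.succAbove k) ((support M i).orderEmbOfFin hi j)) (List.finRange 8) with hm
  set R : Fin 8 → Finset (Fin 15) := fun j =>
    Finset.univ.filter fun k => M (i.succAbove k) ((support M i)ᶜ.orderEmbOfFin hi' j) = true with hR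
  have hRmem : ∀ k j, k ∈ R j ↔ M (i.succAbove k) ((support M i)ᶜ.orderEmbOfFin hi' j) = true := fun k j => by simp [hR]
  have hne : ∀ {k l : Fin 15}, k ≠ l → i.succAbove k ≠ i.succAbove l := fun h =>
    i.succAbove_right_injective.ne h
  have hin : ∀ k : Fin 15, i ≠ i.succAbove k := fun k => (i.succAbove_ne k).symm
  have hp : ∀ k, pop (m k) = (support M i ∩ support M (i.succAbove k)).card := by
    intro k
    rw [hm, pop_bits, card_filter_orderEmbOfFin _ hi fun j => M (i.succAbove k) j = true]
    congr 1
    ext j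
    simp [mem_support]
  have hsum : ∑ k, pop (m k) = ∑ k ∈ Finset.univ.erase i, (support M i ∩ support M k).card := by
    rw [sum_erase_eq_succAbove]
    exact Finset.sum_congr rfl fun k _ => hp k
  refine ⟨m, R, ⟨fun k => ?_, fun k l hkl => ?_, fun k l n hkl hkn hln => ?_, ?_, ?_, ?_⟩⟩
  · have := bits_lt (fun j => M (i.succAbove k) ((support M i).orderEmbOfFin hi j)) (List.finRange 8)
    rwa [List.length_finRange] at this
  · rw [hm, bits_land, pop_bits, card_filter_orderEmbOfFin _ hi
      fun j => (M (i.succAbove k) j && M (i.succAbove l) j) = true]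
    refine le_trans (Finset.card_le_card fun j hj => ?_)
      (card_support_inter_le hM (hin k) (hin l) (hne hkl))
    simpa [mem_support, and_assoc] using hj
  · rw [hm, bits_land, bits_land, pop_bits, card_filter_orderEmbOfFin _ hi
      fun j => (M (i.succAbove k) j && M (i.succAbove l) j && M (i.succAbove n) j) = true]
    have h1 : (Finset.univ.filter fun j => k ∈ R j ∧ l ∈ R j ∧ n ∈ R j).card =
        ((support M i)ᶜ.filter fun j => M (i.succAbove k) j = true ∧ M (i.succAbove l) j = true ∧
          M (i.succAbove n) j = true).card := by
      rw [← card_filter_orderEmbOfFin _ hi']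
      refine congrArg Finset.card (Finset.filter_congr fun j _ => ?_)
      simp only [hRmem]
    rw [h1, ← Finset.card_union_of_disjoint]
    · refine le_trans (Finset.card_le_card fun j hj => ?_)
        (card_support_inter_le hM (hne hkl) (hne hkn) (hne hln))
      simp only [Finset.mem_union, Finset.mem_filter, Bool.and_eq_true] at hj
      simp only [Finset.mem_inter, mem_support]
      rcases hj with ⟨_, ⟨h1, h2⟩, h3⟩ | ⟨_, h1, h2, h3⟩ <;> exact ⟨⟨h1, h2⟩, h3⟩
    · exact Finset.disjoint_filter_filter disjoint_compl_right
  · simp only [hp]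
    have := sum_choose_le Finset.univ (support M i)
      (fun k : Fin 15 => support M i ∩ support M (i.succAbove k))
      (fun k _ => Finset.inter_subset_left) (fun k _ l _ hkl => by
        rw [← Finset.inter_inter_distrib_left, ← Finset.inter_assoc]
        exact card_support_inter_le hM (hin k) (hin l) (hne hkl))
    rw [hi] at this
    exact this
  · rw [hsum]
    exact hT
  · have h1 : ∑ j, (R j).card = ∑ k : Fin 15, ((support M i)ᶜ ∩ support M (i.succAbove k)).card := by
      simp only [hR, Finset.card_filter]
      rw [Finset.sum_comm]
      refine Finset.sum_congr rfl fun k _ => ?_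
      rw [← Finset.card_filter, card_filter_orderEmbOfFin _ hi' fun j => M (i.succAbove k) j = true]
      congr 1
      ext j
      simp [mem_support]
    rw [h1, ← Finset.sum_add_distrib]
    rw [onesCount_eq_sum, Fin.sum_univ_succAbove _ i, hi] at hN
    have h2 : ∑ k, (support M (i.succAbove k)).card = ∑ k : Fin 15, (pop (m k) +
        ((support M i)ᶜ ∩ support M (i.succAbove k)).card) := by
      refine Finset.sum_congr rfl fun k _ => ?_
      rw [hp, ← Finset.card_union_of_disjoint, ← Finset.union_inter_distrib_right,
        Finset.union_compl, Finset.univ_inter]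
      exact Finset.disjoint_of_subset_left Finset.inter_subset_left
        (Finset.disjoint_of_subset_right Finset.inter_subset_left disjoint_compl_right)
    omega

theorem slack_choose_six : ∀ s < 17, 6 * s ≤ s.choose 3 + 20 ∧
    (s.choose 3 + 20 = 6 * s → s = 4 ∨ s = 5) := by
  decide

theorem slack_choose_three : ∀ s < 17, 3 * s ≤ s.choose 3 + 8 := by decide

theorem sum_inter_le {M : Fin 16 → Fin 16 → Bool} (hM : Admissible 3 3 M)
    (hN : 129 ≤ onesCount M) (i : Fin 16) :
    ∑ k ∈ Finset.univ.erase i, (support M i ∩ support M k).card + 10 * (support M i).card ≤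
      (support M i).card ^ 2 + 72 := by
  have hpair : ∀ k ∈ Finset.univ.erase i, ∀ l ∈ Finset.univ.erase i, k ≠ l →
      ((support M i ∩ support M k) ∩ (support M i ∩ support M l)).card ≤ 2 := by
    intro k hk l hl hkl
    rw [← Finset.inter_inter_distrib_left, ← Finset.inter_assoc]
    exact card_support_inter_le hM (Finset.ne_of_mem_erase hk).symm
      (Finset.ne_of_mem_erase hl).symm hkl
  have hch := sum_choose_le (Finset.univ.erase i) (support M i)
    (fun k => support M i ∩ support M k) (fun k _ => Finset.inter_subset_left) hpair
  have hlt : ∀ k, (support M i ∩ support M k).card < 17 := fun k =>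
    Nat.lt_succ_of_le ((Finset.card_le_univ _).trans (by simp))
  have hr : (support M i).card ≤ 16 := (Finset.card_le_univ _).trans (by simp)
  have hc : (Finset.univ.erase i).card = 15 := by simp
  have h0 : ∑ k ∈ Finset.univ.erase i, (support M i ∩ support M k).card ≤
      ∑ k ∈ Finset.univ.erase i, (support M i).card :=
    Finset.sum_le_sum fun k _ => Finset.card_le_card Finset.inter_subset_left
  have h3 : ∑ k ∈ Finset.univ.erase i, 3 * (support M i ∩ support M k).card ≤
      ∑ k ∈ Finset.univ.erase i, ((support M i ∩ support M k).card.choose 3 + 8) :=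
    Finset.sum_le_sum fun k _ => slack_choose_three _ (hlt k)
  have h6 : ∑ k ∈ Finset.univ.erase i, 6 * (support M i ∩ support M k).card ≤
      ∑ k ∈ Finset.univ.erase i, ((support M i ∩ support M k).card.choose 3 + 20) :=
    Finset.sum_le_sum fun k _ => (slack_choose_six _ (hlt k)).1
  have h8 : (support M i).card = 8 →
      ∑ k ∈ Finset.univ.erase i, (support M i ∩ support M k).card < 57 := by
    intro h8
    by_contra! hT
    obtain ⟨m, R, S⟩ := rowStar_of_admissible hM hN i h8 hT
    exact S.elim
  have h9 : (support M i).card = 9 →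
      ∑ k ∈ Finset.univ.erase i, (support M i ∩ support M k).card ≠ 64 := by
    intro h9 hT
    rw [h9, show (9 : ℕ).choose 3 = 84 from rfl] at hch
    have heq : ∀ k ∈ Finset.univ.erase i, 6 * (support M i ∩ support M k).card =
        (support M i ∩ support M k).card.choose 3 + 20 := by
      refine (Finset.sum_eq_sum_iff_of_le fun k _ => (slack_choose_six _ (hlt k)).1).1
        (le_antisymm h6 ?_)
      rw [← Finset.mul_sum, hT, Finset.sum_add_distrib, Finset.sum_const, hc]
      simpa using hch
    have h45 : ∀ k ∈ Finset.univ.erase i, (support M i ∩ support M k).card =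
        4 + if (support M i ∩ support M k).card = 5 then 1 else 0 := by
      intro k hk
      rcases (slack_choose_six _ (hlt k)).2 (heq k hk).symm with h | h <;> simp [h]
    rw [Finset.sum_congr rfl h45, Finset.sum_add_distrib, ← Finset.card_filter, Finset.sum_const,
      hc] at hT
    refine not_four_quintuples
      ((Finset.univ.erase i).filter fun k => (support M i ∩ support M k).card = 5) (support M i)
      (fun k => support M i ∩ support M k) (fun k _ => Finset.inter_subset_left)
      (by simp only [smul_eq_mul] at hT; omega)
      h9 (fun k hk => (Finset.mem_filter.1 hk).2) fun k hk l hl => hpair k (Finset.mem_filter.1 hk).1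
        l (Finset.mem_filter.1 hl).1
  rw [Finset.sum_const, hc, smul_eq_mul] at h0
  rw [← Finset.mul_sum, Finset.sum_add_distrib, Finset.sum_const, hc, smul_eq_mul] at h3 h6
  generalize ∑ k ∈ Finset.univ.erase i, (support M i ∩ support M k).card = T at *
  generalize ∑ k ∈ Finset.univ.erase i, (support M i ∩ support M k).card.choose 3 = C at *
  generalize (support M i).card = r at *
  interval_cases r <;> simp [Nat.choose] at * <;> omega

/-- The transpose of a matrix. -/
def transposed (M : Fin 16 → Fin 16 → Bool) : Fin 16 → Fin 16 → Bool := fun i j => M j i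

theorem admissible_transposed {M : Fin 16 → Fin 16 → Bool} (hM : Admissible 3 3 M) :
    Admissible 3 3 (transposed M) :=
  fun ⟨R, C, hR, hC, h⟩ => hM ⟨C, R, hC, hR, fun i hi j hj => h j hj i hi⟩

theorem card_transposed (M : Fin 16 → Fin 16 → Bool) (j : Fin 16) :
    (support (transposed M) j).card = (Finset.univ.filter fun i => j ∈ support M i).card := by
  congr 1
  ext i
  simp [mem_support, transposed]

theorem onesCount_transposed (M : Fin 16 → Fin 16 → Bool) : onesCount (transposed M) = onesCount M := by
  rw [onesCount_eq_sum, onesCount_eq_sum, Finset.sum_congr rfl fun j _ => card_transposed M j]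
  exact sum_degree _ _ _ fun _ _ => Finset.subset_univ _

theorem sum_sq_le {M : Fin 16 → Fin 16 → Bool} (hM : Admissible 3 3 M) (hN : 129 ≤ onesCount M) :
    ∑ j, (support (transposed M) j).card ^ 2 + 9 * onesCount M ≤
      ∑ i, (support M i).card ^ 2 + 1152 := by
  have h := Finset.sum_le_sum fun i (_ : i ∈ Finset.univ) => sum_inter_le hM hN i
  rw [Finset.sum_add_distrib, Finset.sum_add_distrib, ← Finset.mul_sum, ← onesCount_eq_sum] at h
  have h1 := sum_sq_degree Finset.univ Finset.univ (support M) fun _ _ => Finset.subset_univ _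
  rw [← Finset.sum_congr rfl fun j _ => congrArg (· ^ 2) (card_transposed M j)] at h1
  have h2 : ∑ i, ∑ k, (support M i ∩ support M k).card = ∑ i, ((support M i).card +
      ∑ k ∈ Finset.univ.erase i, (support M i ∩ support M k).card) := by
    refine Finset.sum_congr rfl fun i _ => ?_
    rw [← Finset.add_sum_erase Finset.univ _ (Finset.mem_univ i), Finset.inter_self]
  rw [Finset.sum_add_distrib, ← onesCount_eq_sum] at h2
  simp only [Finset.sum_const, Finset.card_univ, Fintype.card_fin, smul_eq_mul] at h
  omega

theorem onesCount_le {M : Fin 16 → Fin 16 → Bool} (hM : Admissible 3 3 M) : onesCount M ≤ 128 := by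
  by_contra! hN
  have h1 := sum_sq_le hM hN
  have h2 := sum_sq_le (admissible_transposed hM) (by rwa [onesCount_transposed])
  rw [onesCount_transposed, show transposed (transposed M) = M from rfl] at h2
  omega

/-- The rows of an extremal matrix, as binary numbers. -/
def extremalRows : List ℕ :=
  [255, 43605, 21930, 52275, 13260, 26265, 39270, 61455, 4080, 23205, 42330, 15555, 49980, 38505,
    27030, 65280]

/-- A matrix with 128 ones and no all-one `3 × 3` minor: its rows extend the affine planes of an
eight-point space by their complements. -/
def extremal : Fin 16 → Fin 16 → Bool := fun i j => (extremalRows.getD i 0).testBit j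

theorem countP_extremalRows : ∀ i < 16, ∀ k < 16, ∀ l < 16, i < k → k < l →
    ((List.range 16).countP fun j => ((extremalRows.getD i 0).testBit j &&
      (extremalRows.getD k 0).testBit j) && (extremalRows.getD l 0).testBit j) ≤ 2 := by
  decide +kernel

theorem card_extremal_le (i k l : Fin 16) (hik : i < k) (hkl : k < l) :
    (Finset.univ.filter fun j =>
      (extremal i j && extremal k j && extremal l j) = true).card ≤ 2 := by
  have h := countP_extremalRows i i.2 k k.2 l l.2 hik hkl
  rw [← List.map_coe_finRange_eq_range, List.countP_map, List.countP_eq_length_filter] at h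
  simpa [Finset.card, Finset.univ, Fintype.elems, extremal, Function.comp_def] using h

theorem admissible_extremal : Admissible 3 3 extremal := by
  rintro ⟨R, C, hR, hC, h⟩
  have hlt : ∀ {a b : Fin 3}, a < b → R.orderEmbOfFin hR a < R.orderEmbOfFin hR b := fun h =>
    (R.orderEmbOfFin hR).strictMono h
  have h1 := card_extremal_le _ _ _ (hlt (show (0 : Fin 3) < 1 by decide))
    (hlt (show (1 : Fin 3) < 2 by decide))
  have h2 := Finset.card_le_card fun j (hj : j ∈ C) => Finset.mem_filter.2 ⟨Finset.mem_univ j,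
    show (extremal (R.orderEmbOfFin hR 0) j && extremal (R.orderEmbOfFin hR 1) j &&
      extremal (R.orderEmbOfFin hR 2) j) = true by
      simp only [h _ (R.orderEmbOfFin_mem hR _) j hj, Bool.and_self]⟩
  omega

theorem onesCount_extremal : onesCount extremal = 128 := by decide +kernel

/-- `z_3(16, 16) = 128`. -/
theorem stmt18 :
    (∃ M : Fin 16 → Fin 16 → Bool, Admissible 3 3 M ∧ onesCount M = 128) ∧
      ∀ M : Fin 16 → Fin 16 → Bool, Admissible 3 3 M → onesCount M ≤ 128 :=
  ⟨⟨extremal, admissible_extremal, onesCount_extremal⟩, fun _ hM => onesCount_le hM⟩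
end
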